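/- arXiv:1411.5712 — 12 statements merged into one kernel-verified Lean document; each statement's English description precedes it below -/
import Mathlib

section
/- Every feasible symmetric capacitated cost-sharing game on parallel edges admits a strong equilibrium. -/
/-- The load of edge `e` under profile `σ`: the number of agents choosing `e`. -/
def edgeLoad {n : ℕ} {E : Type*} [Fintype E] [DecidableEq E]
    (σ : Fin n → E) (e : E) : ℕ :=
  (Finset.univ.filter fun i => σ i = e).card

/-- A profile is feasible if no edge load exceeds its capacity. -/
def FeasibleP {n : ℕ} {E : Type*} [Fintype E] [DecidableEq E]
    (c : E → ℕ) (σ : Fin n → E) : Prop :=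
  ∀ e, edgeLoad σ e ≤ c e

/-- The cost of agent `i`: the cost of her edge divided equally among its users. -/
noncomputable def agentCostP {n : ℕ} {E : Type*} [Fintype E] [DecidableEq E]
    (p : E → ℝ) (σ : Fin n → E) (i : Fin n) : ℝ :=
  p (σ i) / (edgeLoad σ (σ i) : ℝ)

/-- A feasible profile is a strong equilibrium if no nonempty coalition has a feasible
deviation that strictly decreases the cost of each of its members. -/
def IsStrongEqP {n : ℕ} {E : Type*} [Fintype E] [DecidableEq E]
    (p : E → ℝ) (c : E → ℕ) (σ : Fin n → E) : Prop :=
  FeasibleP c σ ∧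
    ¬ ∃ (C : Finset (Fin n)) (σ' : Fin n → E),
        C.Nonempty ∧ FeasibleP c σ' ∧ (∀ i ∉ C, σ' i = σ i) ∧
        ∀ i ∈ C, agentCostP p σ' i < agentCostP p σ i

/-- The number of agents of `S` choosing the edge `e` under `σ`. -/
def loadOn {A E : Type*} [DecidableEq E] (S : Finset A) (σ : A → E) (e : E) : ℕ :=
  (S.filter fun i => σ i = e).card

section

variable {A E : Type*} [DecidableEq E]

lemma loadOn_le_card (S : Finset A) (σ : A → E) (e : E) : loadOn S σ e ≤ S.card :=
  Finset.card_filter_le _ _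

lemma loadOn_pos {S : Finset A} {σ : A → E} {i : A} (hi : i ∈ S) : 0 < loadOn S σ (σ i) :=
  Finset.card_pos.2 ⟨i, by simp [hi]⟩

lemma loadOn_congr {S : Finset A} {σ τ : A → E} (h : ∀ i ∈ S, σ i = τ i) (e : E) :
    loadOn S σ e = loadOn S τ e := by
  unfold loadOn
  congr 1
  exact Finset.filter_congr fun i hi => by rw [h i hi]

lemma loadOn_of_forall_eq {T : Finset A} {σ : A → E} {e : E} (h : ∀ i ∈ T, σ i = e) :
    loadOn T σ e = T.card := by
  unfold loadOn
  rw [Finset.filter_true_of_mem h]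

lemma loadOn_of_forall_ne {T : Finset A} {σ : A → E} {e : E} (h : ∀ i ∈ T, σ i ≠ e) :
    loadOn T σ e = 0 := by
  unfold loadOn
  rw [Finset.filter_false_of_mem h, Finset.card_empty]

variable [DecidableEq A]

lemma loadOn_eq_add_sdiff {S T : Finset A} (hTS : T ⊆ S) (σ : A → E) (e : E) :
    loadOn S σ e = loadOn T σ e + loadOn (S \ T) σ e := by
  unfold loadOn
  conv_lhs => rw [← Finset.union_sdiff_of_subset hTS, Finset.filter_union]
  exact Finset.card_union_of_disjoint
    (Finset.disjoint_filter_filter Finset.disjoint_sdiff)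

/-- Greedy construction: fill an edge offering the least possible cost per agent, then recurse on
the remaining agents with that edge closed. -/
lemma exists_coalition_proof_profile [Fintype E] [Nonempty E] (p : E → ℝ) (hp : ∀ e, 0 ≤ p e)
    (S : Finset A) (c : E → ℕ) (hS : S.card ≤ ∑ e, c e) :
    ∃ σ : A → E, (∀ e, loadOn S σ e ≤ c e) ∧
      ∀ C ⊆ S, ∀ σ' : A → E, (∀ e, loadOn S σ' e ≤ c e) → (∀ i ∈ S, i ∉ C → σ' i = σ i) →
        (∀ i ∈ C, p (σ' i) / loadOn S σ' (σ' i) < p (σ i) / loadOn S σ (σ i)) → C = ∅ := by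
  induction S using Finset.strongInduction generalizing c with
  | H S ih =>
  rcases S.eq_empty_or_nonempty with rfl | hne
  · exact ⟨fun _ => Classical.arbitrary E, by simp [loadOn],
      fun C hC _ _ _ _ => Finset.subset_empty.1 hC⟩
  have hopen : (Finset.univ.filter fun e => 0 < c e).Nonempty := by
    by_contra hcon
    rw [Finset.not_nonempty_iff_eq_empty, Finset.filter_eq_empty_iff] at hcon
    have h0 : ∑ e, c e = 0 := Finset.sum_eq_zero fun e he => by
      have := hcon he
      omega
    have := hne.card_pos
    omega
  obtain ⟨e, he, hmin⟩ := Finset.exists_min_image _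
    (fun f => p f / ((min (c f) S.card : ℕ) : ℝ)) hopen
  simp only [Finset.mem_filter, Finset.mem_univ, true_and] at he hmin
  obtain ⟨T, hTS, hT⟩ := Finset.exists_subset_card_eq (min_le_right (c e) S.card)
  have hTpos : 0 < T.card := by
    rw [hT]
    exact lt_min he hne.card_pos
  have hrest : (S \ T).card ≤ ∑ f, Function.update c e 0 f := by
    rw [Finset.card_sdiff_of_subset hTS, Finset.sum_update_of_mem (Finset.mem_univ e)]
    have := Finset.sum_eq_add_sum_sdiff_singleton_of_mem (Finset.mem_univ e) c
    omega
  obtain ⟨τ, hτ, hstable⟩ := ih (S \ T)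
    (Finset.sdiff_ssubset hTS (Finset.card_pos.1 hTpos)) (Function.update c e 0) hrest
  have hτe : ∀ i ∈ S \ T, τ i ≠ e := fun i hi hie => by
    have h1 := loadOn_pos (σ := τ) hi
    have h2 := hτ e
    rw [Function.update_self] at h2
    rw [hie] at h1
    omega
  have load_self : ∀ ρ : A → E, (∀ i ∈ T, ρ i = e) → (∀ i ∈ S \ T, ρ i ≠ e) →
      loadOn S ρ e = T.card := fun ρ h1 h2 => by
    rw [loadOn_eq_add_sdiff hTS, loadOn_of_forall_eq h1, loadOn_of_forall_ne h2, add_zero]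
  have load_ne : ∀ ρ : A → E, (∀ i ∈ T, ρ i = e) → ∀ f ≠ e,
      loadOn S ρ f = loadOn (S \ T) ρ f := fun ρ h1 f hf => by
    rw [loadOn_eq_add_sdiff hTS, loadOn_of_forall_ne (T := T) (e := f), zero_add]
    intro i hi
    rw [h1 i hi]
    exact hf.symm
  let σ : A → E := fun i => if i ∈ T then e else τ i
  have hσT : ∀ i ∈ T, σ i = e := fun i hi => if_pos hi
  have hσR : ∀ i ∈ S \ T, σ i = τ i := fun i hi => if_neg (Finset.mem_sdiff.1 hi).2
  have hσe : loadOn S σ e = T.card :=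
    load_self σ hσT fun i hi => by rw [hσR i hi]; exact hτe i hi
  have hσf : ∀ f ≠ e, loadOn S σ f = loadOn (S \ T) τ f := fun f hf => by
    rw [load_ne σ hσT f hf, loadOn_congr hσR]
  refine ⟨σ, fun f => ?_, fun C hC σ' hσ' hfix himp => ?_⟩
  · by_cases hf : f = e
    · subst hf
      rw [hσe, hT]
      exact min_le_left _ _
    · rw [hσf f hf]
      simpa [hf] using hτ f
  have hCT : ∀ i ∈ C, i ∉ T := fun i hiC hiT => by
    have hlt := himp i hiC
    have hpos := loadOn_pos (σ := σ') (hC hiC)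
    have hle := le_min (hσ' (σ' i)) (loadOn_le_card S σ' (σ' i))
    rw [hσT i hiT, hσe, hT] at hlt
    have h1 := hmin (σ' i) (hpos.trans_le (hσ' _))
    have h2 : p (σ' i) / ((min (c (σ' i)) S.card : ℕ) : ℝ) ≤
        p (σ' i) / (loadOn S σ' (σ' i) : ℝ) :=
      div_le_div_of_nonneg_left (hp _) (by exact_mod_cast hpos) (by exact_mod_cast hle)
    linarith
  have hσ'T : ∀ i ∈ T, σ' i = e := fun i hi => by
    rw [hfix i (hTS hi) fun hiC => hCT i hiC hi, hσT i hi]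
  have hσ'e : ∀ i ∈ S \ T, σ' i ≠ e := fun i hi hie => by
    have h1 := loadOn_pos (σ := σ') hi
    have h2 := le_min (hσ' e) (loadOn_le_card S σ' e)
    rw [loadOn_eq_add_sdiff hTS, loadOn_of_forall_eq hσ'T, ← hT] at h2
    rw [hie] at h1
    omega
  have hCR : C ⊆ S \ T := fun i hi => Finset.mem_sdiff.2 ⟨hC hi, hCT i hi⟩
  refine hstable C hCR σ' (fun f => ?_) (fun i hi hiC => ?_) fun i hi => ?_
  · by_cases hf : f = e
    · subst hf
      rw [loadOn_of_forall_ne hσ'e]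
      exact Nat.zero_le _
    · rw [← load_ne σ' hσ'T f hf]
      simpa [hf] using hσ' f
  · rw [hfix i (Finset.mem_sdiff.1 hi).1 hiC, hσR i hi]
  · have h := himp i hi
    rwa [load_ne σ' hσ'T _ (hσ'e i (hCR hi)), hσR i (hCR hi),
      hσf _ (hτe i (hCR hi))] at h

end

/-- Every feasible symmetric capacitated cost-sharing game on parallel edges
admits a strong equilibrium. -/
theorem parallel_edges_admits_strong_equilibrium
    {n : ℕ} (hn : 1 ≤ n) {E : Type*} [Fintype E] [DecidableEq E] [Nonempty E]
    (p : E → ℝ) (hp : ∀ e, 0 ≤ p e) (c : E → ℕ)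
    (hfeas : ∃ σ : Fin n → E, FeasibleP c σ) :
    ∃ σ : Fin n → E, IsStrongEqP p c σ := by
  obtain ⟨σ₀, hσ₀⟩ := hfeas
  have hcard : (Finset.univ : Finset (Fin n)).card ≤ ∑ e, c e := by
    rw [Finset.card_eq_sum_card_fiberwise (f := σ₀) (t := Finset.univ) (by simp)]
    exact Finset.sum_le_sum fun e _ => hσ₀ e
  obtain ⟨σ, hσ, hstable⟩ := exists_coalition_proof_profile p hp Finset.univ c hcard
  refine ⟨σ, hσ, ?_⟩
  rintro ⟨C, σ', hC, hσ', hfix, himp⟩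
  exact hC.ne_empty
    (hstable C (Finset.subset_univ C) σ' hσ' (fun i _ hi => hfix i hi) himp)
end

section
/- Every feasible symmetric capacitated cost-sharing game on a series of k parallel-edge blocks admits a strong equilibrium. -/
/-- The load of edge `e` of block `j` under profile `σ`. -/
def blockLoad {n k : ℕ} {E : Fin k → Type*} [∀ j, Fintype (E j)] [∀ j, DecidableEq (E j)]
    (σ : Fin n → ∀ j, E j) (j : Fin k) (e : E j) : ℕ :=
  (Finset.univ.filter fun i => σ i j = e).card

/-- A profile is feasible if no edge load exceeds its capacity. -/
def FeasibleB {n k : ℕ} {E : Fin k → Type*} [∀ j, Fintype (E j)] [∀ j, DecidableEq (E j)]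
    (c : ∀ j, E j → ℕ) (σ : Fin n → ∀ j, E j) : Prop :=
  ∀ j e, blockLoad σ j e ≤ c j e

/-- The cost of agent `i`: in each block, the cost of her chosen edge divided equally
among its users, summed over all blocks. -/
noncomputable def agentCostB {n k : ℕ} {E : Fin k → Type*}
    [∀ j, Fintype (E j)] [∀ j, DecidableEq (E j)]
    (p : ∀ j, E j → ℝ) (σ : Fin n → ∀ j, E j) (i : Fin n) : ℝ :=
  ∑ j, p j (σ i j) / (blockLoad σ j (σ i j) : ℝ)

/-- The social cost of a profile: the sum of all agents' costs. -/
noncomputable def socialCostB {n k : ℕ} {E : Fin k → Type*}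
    [∀ j, Fintype (E j)] [∀ j, DecidableEq (E j)]
    (p : ∀ j, E j → ℝ) (σ : Fin n → ∀ j, E j) : ℝ :=
  ∑ i, agentCostB p σ i

/-- A feasible profile is a strong equilibrium if no nonempty coalition has a feasible
deviation that strictly decreases the cost of each of its members. -/
def IsStrongEqB {n k : ℕ} {E : Fin k → Type*} [∀ j, Fintype (E j)] [∀ j, DecidableEq (E j)]
    (p : ∀ j, E j → ℝ) (c : ∀ j, E j → ℕ) (σ : Fin n → ∀ j, E j) : Prop :=
  FeasibleB c σ ∧
    ¬ ∃ (C : Finset (Fin n)) (σ' : Fin n → ∀ j, E j),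
        C.Nonempty ∧ FeasibleB c σ' ∧ (∀ i ∉ C, σ' i = σ i) ∧
        ∀ i ∈ C, agentCostB p σ' i < agentCostB p σ i

/-- A finite set in a linear order has an initial segment of every smaller cardinality. -/
theorem exists_initial_segment_card {α : Type*} [LinearOrder α] (A : Finset α) (m : ℕ)
    (hm : m ≤ A.card) :
    ∃ B ⊆ A, B.card = m ∧ ∀ x ∈ B, ∀ y ∈ A \ B, x < y := by
  induction m with
  | zero => exact ⟨∅, by simp, by simp, by simp⟩
  | succ m ih =>
    obtain ⟨B, hBA, hB, hlt⟩ := ih (by omega)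
    have hne : (A \ B).Nonempty := by
      rw [← Finset.card_pos, Finset.card_sdiff_of_subset hBA]
      omega
    have hmin := Finset.min'_mem _ hne
    have hmin' := Finset.mem_sdiff.mp hmin
    refine ⟨insert ((A \ B).min' hne) B, ?_, ?_, ?_⟩
    · exact Finset.insert_subset hmin'.1 hBA
    · rw [Finset.card_insert_of_notMem hmin'.2, hB]
    · intro x hx y hy
      simp only [Finset.mem_sdiff, Finset.mem_insert, not_or] at hy
      have hyA : y ∈ A \ B := Finset.mem_sdiff.mpr ⟨hy.1, hy.2.2⟩
      rcases Finset.mem_insert.mp hx with rfl | hx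
      · exact lt_of_le_of_ne (Finset.min'_le _ _ hyA) (Ne.symm hy.2.1)
      · exact hlt x hx y hyA

/-- In a single block, the greedy assignment of the ordered agents `A` to the edges `S` has the
property that no agent can be better off in a feasible assignment which keeps the choices of
all her predecessors. -/
theorem exists_greedy_assignment {α ε : Type*} [LinearOrder α] [DecidableEq ε] [Nonempty ε]
    (p : ε → ℝ) (hp : ∀ e, 0 ≤ p e) (c : ε → ℕ) (S : Finset ε) (A : Finset α)
    (hA : A.card ≤ ∑ e ∈ S, c e) :
    ∃ f : α → ε, (∀ i ∈ A, f i ∈ S) ∧ (∀ e, (A.filter (f · = e)).card ≤ c e) ∧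
      ∀ i ∈ A, ∀ g : α → ε, (∀ a ∈ A, g a ∈ S) → (∀ e, (A.filter (g · = e)).card ≤ c e) →
        (∀ a ∈ A, a < i → g a = f a) →
        p (f i) / ((A.filter (f · = f i)).card : ℝ) ≤
          p (g i) / ((A.filter (g · = g i)).card : ℝ) := by
  induction S using Finset.strongInduction generalizing A with
  | H S ih =>
  rcases A.eq_empty_or_nonempty with rfl | hne
  · exact ⟨fun _ => Classical.arbitrary ε, by simp, by simp, by simp⟩
  have hApos := hne.card_pos
  obtain ⟨e, he, hmin⟩ : ∃ e ∈ S.filter (0 < c ·), ∀ d ∈ S.filter (0 < c ·),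
      p e / (min (c e) A.card : ℕ) ≤ p d / (min (c d) A.card : ℕ) := by
    apply Finset.exists_min_image
    obtain ⟨e, he, hc⟩ := Finset.exists_ne_zero_of_sum_ne_zero (s := S) (f := c) (by omega)
    exact ⟨e, Finset.mem_filter.mpr ⟨he, Nat.pos_of_ne_zero hc⟩⟩
  obtain ⟨heS, hce⟩ := Finset.mem_filter.mp he
  obtain ⟨B, hBA, hB, hlt⟩ := exists_initial_segment_card A (min (c e) A.card) (by omega)
  have hcard := Finset.card_sdiff_of_subset hBA
  have hsum := Finset.add_sum_erase S c heS
  obtain ⟨f, hfS, hfc, hf⟩ := ih (S.erase e) (Finset.erase_ssubset heS) (A \ B) (by omega)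
  have split (g : α → ε) (d : ε) : (A.filter (g · = d)).card =
      (B.filter (g · = d)).card + ((A \ B).filter (g · = d)).card := by
    conv_lhs => rw [← Finset.union_sdiff_of_subset hBA]
    rw [Finset.filter_union, Finset.card_union_of_disjoint
      (Finset.disjoint_filter_filter Finset.disjoint_sdiff)]
  have full (g : α → ε) (hg : ∀ a ∈ B, g a = e) : (B.filter (g · = e)).card = B.card := by
    rw [Finset.filter_true_of_mem hg]
  have none (g : α → ε) (hg : ∀ a ∈ B, g a = e) (d : ε) (hd : d ≠ e) :
      (B.filter (g · = d)).card = 0 := by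
    rw [Finset.card_eq_zero, Finset.filter_eq_empty_iff]
    intro a ha h
    exact hd (h.symm.trans (hg a ha))
  let F : α → ε := fun a => if a ∈ B then e else f a
  have hFB : ∀ a ∈ B, F a = e := fun a ha => if_pos ha
  have hFf : ∀ a ∈ A \ B, F a = f a := fun a ha => if_neg (Finset.mem_sdiff.mp ha).2
  have hFfilter (d : ε) : (A \ B).filter (F · = d) = (A \ B).filter (f · = d) :=
    Finset.filter_congr fun a ha => by rw [hFf a ha]
  have hFe : (A.filter (F · = e)).card = min (c e) A.card := by
    rw [split, full F hFB, hB, hFfilter, Nat.add_eq_left, Finset.card_eq_zero,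
      Finset.filter_eq_empty_iff]
    exact fun a ha => Finset.ne_of_mem_erase (hfS a ha)
  have hFd (d : ε) (hd : d ≠ e) :
      (A.filter (F · = d)).card = ((A \ B).filter (f · = d)).card := by
    rw [split, none F hFB d hd, hFfilter, zero_add]
  refine ⟨F, fun a ha => ?_, fun d => ?_, fun i hi g hgS hgc hgF => ?_⟩
  · by_cases haB : a ∈ B
    · rwa [hFB a haB]
    · have h := Finset.mem_sdiff.mpr ⟨ha, haB⟩
      rw [hFf a h]
      exact Finset.mem_of_mem_erase (hfS a h)
  · by_cases hd : d = e
    · subst hd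
      rw [hFe]
      exact min_le_left _ _
    · rw [hFd d hd]
      exact hfc d
  · by_cases hiB : i ∈ B
    · have hpos : 0 < (A.filter (g · = g i)).card :=
        Finset.card_pos.mpr ⟨i, Finset.mem_filter.mpr ⟨hi, rfl⟩⟩
      rw [hFB i hiB, hFe]
      refine (hmin (g i) (Finset.mem_filter.mpr ⟨hgS i hi, hpos.trans_le (hgc _)⟩)).trans ?_
      refine div_le_div_of_nonneg_left (hp _) (by exact_mod_cast hpos) ?_
      exact_mod_cast le_min (hgc _) (Finset.card_filter_le _ _)
    · have hi' := Finset.mem_sdiff.mpr ⟨hi, hiB⟩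
      have hgB : ∀ a ∈ B, g a = e := fun a ha =>
        (hgF a (hBA ha) (hlt a ha i hi')).trans (hFB a ha)
      have hBfull : B.card = c e := by
        have := Finset.card_pos.mpr ⟨i, hi'⟩
        omega
      have hge : ∀ a ∈ A \ B, g a ≠ e := by
        have h := hgc e
        rw [split, full g hgB] at h
        have h0 : ((A \ B).filter (g · = e)).card = 0 := by omega
        rwa [Finset.card_eq_zero, Finset.filter_eq_empty_iff] at h0
      have hgd (d : ε) (hd : d ≠ e) :
          (A.filter (g · = d)).card = ((A \ B).filter (g · = d)).card := by
        rw [split, none g hgB d hd, zero_add]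
      rw [hFf i hi', hFd _ (Finset.ne_of_mem_erase (hfS i hi')), hgd _ (hge i hi')]
      refine hf i hi' g (fun a ha => ?_) (fun d => ?_) (fun a ha hai => ?_)
      · exact Finset.mem_erase.mpr ⟨hge a ha, hgS a (Finset.mem_sdiff.mp ha).1⟩
      · have := split g d
        have := hgc d
        omega
      · rw [hgF a (Finset.mem_sdiff.mp ha).1 hai, hFf a ha]

/-- Every feasible symmetric capacitated cost-sharing game on a series of `k`
parallel-edge blocks admits a strong equilibrium. -/
theorem series_of_parallel_blocks_admits_strong_equilibrium
    {n k : ℕ} (hn : 1 ≤ n) (hk : 1 ≤ k)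
    {E : Fin k → Type*} [∀ j, Fintype (E j)] [∀ j, DecidableEq (E j)] [∀ j, Nonempty (E j)]
    (p : ∀ j, E j → ℝ) (hp : ∀ j e, 0 ≤ p j e) (c : ∀ j, E j → ℕ)
    (hfeas : ∃ σ : Fin n → ∀ j, E j, FeasibleB c σ) :
    ∃ σ : Fin n → ∀ j, E j, IsStrongEqB p c σ := by
  obtain ⟨τ, hτ⟩ := hfeas
  have hcap (j : Fin k) : (Finset.univ : Finset (Fin n)).card ≤ ∑ e, c j e := by
    rw [Finset.card_eq_sum_card_fiberwise (f := fun i => τ i j) (t := Finset.univ) (by simp)]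
    exact Finset.sum_le_sum fun e _ => hτ j e
  choose f _ hfc hf using fun j =>
    exists_greedy_assignment (p j) (hp j) (c j) Finset.univ Finset.univ (hcap j)
  refine ⟨fun i j => f j i, hfc, ?_⟩
  rintro ⟨C, σ', hC, hσ', hout, himp⟩
  refine (himp _ (C.min'_mem hC)).not_ge (Finset.sum_le_sum fun j _ => ?_)
  refine hf j _ (Finset.mem_univ _) (fun i => σ' i j) (by simp) (hσ' j) fun a _ ha => ?_
  have haC : a ∉ C := fun h => (C.min'_le a h).not_gt ha
  exact congrFun (hout a haC) j
end

section
/- Consider the capacitated fair cost-sharing congestion game with two agents and four resources a, b, c, d, with costs p(a) = 1, p(b) = 6/5, p(c) = 1/10, p(d) = 1/2, capacities c(a) = 1, c(b) = 2, c(c) = 1, c(d) = 1, where both agents have the same strategy set consisting of the three resource sets {a}, {b,c}, {b,d} (corresponding to the three source–sink paths of a simple extension-parallel network). This game is feasible but admits no strong equilibrium. -/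
/-- The load of resource `e` under profile `s`: the number of agents whose strategy
contains `e`. -/
def resLoad {n : ℕ} {E : Type*} [Fintype E] [DecidableEq E]
    (s : Fin n → Finset E) (e : E) : ℕ :=
  (Finset.univ.filter fun i => e ∈ s i).card

/-- A profile is feasible if no resource load exceeds its capacity. -/
def FeasibleC {n : ℕ} {E : Type*} [Fintype E] [DecidableEq E]
    (c : E → ℕ) (s : Fin n → Finset E) : Prop :=
  ∀ e, resLoad s e ≤ c e

/-- The cost of agent `i`: the sum, over the resources she uses, of the resource cost
divided equally among its users. -/
noncomputable def agentCostC {n : ℕ} {E : Type*} [Fintype E] [DecidableEq E]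
    (p : E → ℝ) (s : Fin n → Finset E) (i : Fin n) : ℝ :=
  ∑ e ∈ s i, p e / (resLoad s e : ℝ)

/-- The social cost of a profile: the sum of all agents' costs. -/
noncomputable def socialCostC {n : ℕ} {E : Type*} [Fintype E] [DecidableEq E]
    (p : E → ℝ) (s : Fin n → Finset E) : ℝ :=
  ∑ i, agentCostC p s i

/-- A profile of allowed strategies is a strong equilibrium if it is feasible and no
nonempty coalition has a feasible deviation (into allowed strategies) that strictly
decreases the cost of each of its members. -/
def IsStrongEqC {n : ℕ} {E : Type*} [Fintype E] [DecidableEq E]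
    (St : Fin n → Set (Finset E)) (p : E → ℝ) (c : E → ℕ) (s : Fin n → Finset E) : Prop :=
  (∀ i, s i ∈ St i) ∧ FeasibleC c s ∧
    ¬ ∃ (C : Finset (Fin n)) (s' : Fin n → Finset E),
        C.Nonempty ∧ (∀ i, s' i ∈ St i) ∧ FeasibleC c s' ∧ (∀ i ∉ C, s' i = s i) ∧
        ∀ i ∈ C, agentCostC p s' i < agentCostC p s i

/-- Costs of the four resources `a, b, c, d` (encoded as `0, 1, 2, 3`). -/
noncomputable def pEx : Fin 4 → ℝ := ![1, 6/5, 1/10, 1/2]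

/-- Capacities of the four resources `a, b, c, d`. -/
def cEx : Fin 4 → ℕ := ![1, 2, 1, 1]

/-- The common strategy set `{{a}, {b,c}, {b,d}}`. -/
def StEx : Set (Finset (Fin 4)) := {({0} : Finset (Fin 4)), {1, 2}, {1, 3}}

/-- In a two-agent game the load of a resource is the sum of the two membership indicators. -/
theorem resLoad_eq_of_ne {E : Type*} [Fintype E] [DecidableEq E] {i j : Fin 2} (hij : i ≠ j)
    (s : Fin 2 → Finset E) (e : E) :
    resLoad s e = (if e ∈ s i then 1 else 0) + (if e ∈ s j then 1 else 0) := by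
  have huniv : (Finset.univ : Finset (Fin 2)) = {i, j} := by
    revert i j; decide
  rw [resLoad, Finset.card_filter, huniv, Finset.sum_pair hij]

theorem agentCostC_a {s : Fin 2 → Finset (Fin 4)} {i j : Fin 2} (hij : i ≠ j)
    (hi : s i = {0}) (hj : s j = {1, 2} ∨ s j = {1, 3}) : agentCostC pEx s i = 1 := by
  rcases hj with hj | hj <;> simp [agentCostC, resLoad_eq_of_ne hij, hi, hj, pEx]

theorem agentCostC_bc_alone {s : Fin 2 → Finset (Fin 4)} {i j : Fin 2} (hij : i ≠ j)
    (hi : s i = {1, 2}) (hj : s j = {0}) : agentCostC pEx s i = 13 / 10 := by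
  simp [agentCostC, resLoad_eq_of_ne hij, hi, hj, pEx]; norm_num

theorem agentCostC_bc_shared {s : Fin 2 → Finset (Fin 4)} {i j : Fin 2} (hij : i ≠ j)
    (hi : s i = {1, 2}) (hj : s j = {1, 3}) : agentCostC pEx s i = 7 / 10 := by
  simp [agentCostC, resLoad_eq_of_ne hij, hi, hj, pEx]; norm_num

theorem agentCostC_bd_shared {s : Fin 2 → Finset (Fin 4)} {i j : Fin 2} (hij : i ≠ j)
    (hi : s i = {1, 3}) (hj : s j = {1, 2}) : agentCostC pEx s i = 11 / 10 := by
  simp [agentCostC, resLoad_eq_of_ne hij, hi, hj, pEx]; norm_num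

theorem feasibleC_a_bc {s : Fin 2 → Finset (Fin 4)} {i j : Fin 2} (hij : i ≠ j)
    (hi : s i = {0}) (hj : s j = {1, 2}) : FeasibleC cEx s := by
  intro e
  rw [resLoad_eq_of_ne hij, hi, hj]
  revert e; decide

theorem feasibleC_bc_bd {s : Fin 2 → Finset (Fin 4)} {i j : Fin 2} (hij : i ≠ j)
    (hi : s i = {1, 2}) (hj : s j = {1, 3}) : FeasibleC cEx s := by
  intro e
  rw [resLoad_eq_of_ne hij, hi, hj]
  revert e; decide

/-- Two agents cannot both use the same strategy: each strategy has a resource of capacity one. -/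
theorem FeasibleC.strategy_ne {s : Fin 2 → Finset (Fin 4)} (hs : ∀ i, s i ∈ StEx)
    (hf : FeasibleC cEx s) {i j : Fin 2} (hij : i ≠ j) : s i ≠ s j := by
  intro h
  have hload : ∀ e ∈ s i, 2 ≤ cEx e := by
    intro e he
    have := hf e
    rwa [resLoad_eq_of_ne hij, if_pos he, if_pos (h ▸ he)] at this
  rcases hs i with hi | hi | hi <;> rw [hi] at hload <;> revert hload <;> decide

/-- A strictly profitable unilateral deviation rules out a strong equilibrium. -/
theorem IsStrongEqC.le_agentCostC_update {n : ℕ} {E : Type*} [Fintype E] [DecidableEq E]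
    {St : Fin n → Set (Finset E)} {p : E → ℝ} {c : E → ℕ} {s : Fin n → Finset E}
    (h : IsStrongEqC St p c s) {i : Fin n} {t : Finset E} (ht : t ∈ St i)
    (hf : FeasibleC c (Function.update s i t)) :
    agentCostC p s i ≤ agentCostC p (Function.update s i t) i := by
  by_contra! hlt
  refine h.2.2 ⟨{i}, Function.update s i t, Finset.singleton_nonempty i, fun k => ?_, hf,
    fun k hk => Function.update_of_ne (by simpa using hk) _ _, by simpa using hlt⟩
  rcases eq_or_ne k i with rfl | hk
  · simpa using ht
  · simpa [hk] using h.1 k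

theorem not_isStrongEqC_a_bc {s : Fin 2 → Finset (Fin 4)} {i j : Fin 2} (hij : i ≠ j)
    (hi : s i = {0}) (hj : s j = {1, 2}) : ¬ IsStrongEqC (fun _ => StEx) pEx cEx s := by
  intro h
  have hcover : ∀ k, k = i ∨ k = j := by omega
  set s' : Fin 2 → Finset (Fin 4) := Function.update (fun _ => {1, 3}) i {1, 2}
  have hi' : s' i = {1, 2} := Function.update_self ..
  have hj' : s' j = {1, 3} := Function.update_of_ne hij.symm ..
  refine h.2.2 ⟨Finset.univ, s', Finset.univ_nonempty, fun k => ?_, feasibleC_bc_bd hij hi' hj',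
    fun k hk => absurd (Finset.mem_univ k) hk, fun k _ => ?_⟩
  · rcases hcover k with rfl | rfl
    · simp [hi', StEx]
    · simp [hj', StEx]
  · rcases hcover k with rfl | rfl
    · rw [agentCostC_bc_shared hij hi' hj', agentCostC_a hij hi (.inl hj)]; norm_num
    · rw [agentCostC_bd_shared hij.symm hj' hi', agentCostC_bc_alone hij.symm hj hi]; norm_num

theorem not_isStrongEqC_a_bd {s : Fin 2 → Finset (Fin 4)} {i j : Fin 2} (hij : i ≠ j)
    (hi : s i = {0}) (hj : s j = {1, 3}) : ¬ IsStrongEqC (fun _ => StEx) pEx cEx s := by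
  intro h
  have hi' : Function.update s i {1, 2} i = {1, 2} := Function.update_self ..
  have hj' : Function.update s i {1, 2} j = {1, 3} := by
    rw [Function.update_of_ne hij.symm, hj]
  have hle := h.le_agentCostC_update (i := i) (by simp [StEx]) (feasibleC_bc_bd hij hi' hj')
  rw [agentCostC_a hij hi (.inr hj), agentCostC_bc_shared hij hi' hj'] at hle
  norm_num at hle

theorem not_isStrongEqC_bc_bd {s : Fin 2 → Finset (Fin 4)} {i j : Fin 2} (hij : i ≠ j)
    (hi : s i = {1, 2}) (hj : s j = {1, 3}) : ¬ IsStrongEqC (fun _ => StEx) pEx cEx s := by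
  intro h
  have hj' : Function.update s j {0} j = {0} := Function.update_self ..
  have hi' : Function.update s j {0} i = {1, 2} := by
    rw [Function.update_of_ne hij, hi]
  have hle := h.le_agentCostC_update (i := j) (by simp [StEx]) (feasibleC_a_bc hij.symm hj' hi')
  rw [agentCostC_bd_shared hij.symm hj hi, agentCostC_a hij.symm hj' (.inl hi')] at hle
  norm_num at hle

/-- The two-agent game on resources `a, b, c, d` with costs `1, 6/5, 1/10, 1/2`,
capacities `1, 2, 1, 1` and common strategy set `{{a}, {b,c}, {b,d}}` is feasible
but admits no strong equilibrium. -/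
theorem example_game_feasible_but_no_strong_equilibrium :
    (∃ s : Fin 2 → Finset (Fin 4), (∀ i, s i ∈ StEx) ∧ FeasibleC cEx s) ∧
      ¬ ∃ s : Fin 2 → Finset (Fin 4), IsStrongEqC (fun _ => StEx) pEx cEx s := by
  have h01 : (0 : Fin 2) ≠ 1 := by decide
  refine ⟨⟨![{0}, {1, 2}], fun i => ?_, feasibleC_a_bc h01 rfl rfl⟩, ?_⟩
  · fin_cases i <;> simp [StEx]
  · rintro ⟨s, h⟩
    have hne := FeasibleC.strategy_ne h.1 h.2.1 h01
    rcases h.1 0 with h0 | h0 | h0 <;> rcases h.1 1 with h1 | h1 | h1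
    · exact hne (h0.trans h1.symm)
    · exact not_isStrongEqC_a_bc h01 h0 h1 h
    · exact not_isStrongEqC_a_bd h01 h0 h1 h
    · exact not_isStrongEqC_a_bc h01.symm h1 h0 h
    · exact hne (h0.trans h1.symm)
    · exact not_isStrongEqC_bc_bd h01 h0 h1 h
    · exact not_isStrongEqC_a_bd h01.symm h1 h0 h
    · exact not_isStrongEqC_bc_bd h01.symm h1 h0 h
    · exact hne (h0.trans h1.symm)
end

section
/- In the capacitated fair cost-sharing congestion game with two agents and four resources a, b, c, d, with costs p(a) = 1, p(b) = 6/5, p(c) = 1/10, p(d) = 1/2, capacities c(a) = 1, c(b) = 2, c(c) = 1, c(d) = 1, where both agents have the same strategy set {{a}, {b,c}, {b,d}}, the Nash equilibria are exactly the two profiles in which one agent plays {a} and the other plays {b,c}. -/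
/-- A profile of allowed strategies is a Nash equilibrium if it is feasible and no
single agent has an allowed alternative strategy whose unilateral, feasible adoption
strictly decreases her cost. -/
def IsNashEqC {n : ℕ} {E : Type*} [Fintype E] [DecidableEq E]
    (St : Fin n → Set (Finset E)) (p : E → ℝ) (c : E → ℕ) (s : Fin n → Finset E) : Prop :=
  (∀ i, s i ∈ St i) ∧ FeasibleC c s ∧
    ∀ (i : Fin n) (t : Finset E), t ∈ St i → FeasibleC c (Function.update s i t) →
      agentCostC p s i ≤ agentCostC p (Function.update s i t) i

/-- The load of a resource in a two-agent profile. -/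
theorem resLoad_pair {E : Type*} [Fintype E] [DecidableEq E] (x y : Finset E) (e : E) :
    resLoad ![x, y] e = (if e ∈ x then 1 else 0) + (if e ∈ y then 1 else 0) := by
  rw [resLoad, Finset.card_filter, Fin.sum_univ_two]
  rfl

/-- The Nash condition for a two-agent game, with the deviations of each agent spelled out. -/
theorem isNashEqC_pair_iff {E : Type*} [Fintype E] [DecidableEq E] (S : Set (Finset E))
    (p : E → ℝ) (c : E → ℕ) (x y : Finset E) :
    IsNashEqC (fun _ => S) p c ![x, y] ↔
      (x ∈ S ∧ y ∈ S) ∧ FeasibleC c ![x, y] ∧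
        (∀ t ∈ S, FeasibleC c ![t, y] → agentCostC p ![x, y] 0 ≤ agentCostC p ![t, y] 0) ∧
        ∀ t ∈ S, FeasibleC c ![x, t] → agentCostC p ![x, y] 1 ≤ agentCostC p ![x, t] 1 := by
  have h0 (t : Finset E) : Function.update ![x, y] 0 t = ![t, y] := by
    ext i : 1; fin_cases i <;> simp
  have h1 (t : Finset E) : Function.update ![x, y] 1 t = ![x, t] := by
    ext i : 1; fin_cases i <;> simp
  simp only [IsNashEqC, Fin.forall_fin_two, h0, h1]
  rfl

/-- In the two-agent game on resources `a, b, c, d` with costs `1, 6/5, 1/10, 1/2`,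
capacities `1, 2, 1, 1` and common strategy set `{{a}, {b,c}, {b,d}}`, the Nash
equilibria are exactly the two profiles in which one agent plays `{a}` and the other
plays `{b, c}`. -/
theorem example_game_nash_equilibria_characterization
    (s : Fin 2 → Finset (Fin 4)) :
    IsNashEqC (fun _ => StEx) pEx cEx s ↔
      ((s 0 = {0} ∧ s 1 = {1, 2}) ∨ (s 0 = {1, 2} ∧ s 1 = {0})) := by
  obtain ⟨x, y, rfl⟩ : ∃ x y, s = ![x, y] :=
    ⟨s 0, s 1, by ext i : 1; fin_cases i <;> rfl⟩
  have h1 : ({0} : Finset (Fin 4)) ≠ {1, 2} := by decide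
  have h2 : ({1, 3} : Finset (Fin 4)) ≠ {1, 2} := by decide
  have h3 : ({1, 3} : Finset (Fin 4)) ≠ {0} := by decide
  rw [isNashEqC_pair_iff]
  simp only [Matrix.cons_val_zero, Matrix.cons_val_one]
  by_cases hxy : x ∈ StEx ∧ y ∈ StEx
  · obtain ⟨hx, hy⟩ := hxy
    simp only [StEx, Set.mem_insert_iff, Set.mem_singleton_iff] at hx hy
    rcases hx with rfl | rfl | rfl <;> rcases hy with rfl | rfl | rfl <;>
      simp [StEx, FeasibleC, Fin.forall_fin_succ, resLoad_pair, agentCostC, pEx, cEx,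
        h1, h1.symm, h2, h3] <;> norm_num
  · refine iff_of_false (fun h => hxy h.1) ?_
    rintro (⟨rfl, rfl⟩ | ⟨rfl, rfl⟩) <;> exact hxy (by simp [StEx])
end

section
/- Let σ be a strong equilibrium of a symmetric capacitated cost-sharing game on a series of k parallel-edge blocks. Then for every block j ∈ {1, …, k}, the induced profile i ↦ σ i j is a strong equilibrium of the symmetric capacitated cost-sharing game on parallel edges with the same n agents, edge set E_j, costs p_j, and capacities c_j. -/
/-- The social cost of a profile: the sum of all agents' costs. -/
noncomputable def socialCostP {n : ℕ} {E : Type*} [Fintype E] [DecidableEq E]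
    (p : E → ℝ) (σ : Fin n → E) : ℝ :=
  ∑ i, agentCostP p σ i

/-- Replacing the choices of all agents in block `j` by `τ` gives load `edgeLoad τ` there. -/
theorem blockLoad_update_self {n k : ℕ} {E : Fin k → Type*}
    [∀ j, Fintype (E j)] [∀ j, DecidableEq (E j)]
    (σ : Fin n → ∀ j, E j) (j : Fin k) (τ : Fin n → E j) (e : E j) :
    blockLoad (fun i => Function.update (σ i) j (τ i)) j e = edgeLoad τ e := by
  simp [blockLoad, edgeLoad]

/-- Replacing the choices of all agents in block `j` leaves the loads of other blocks unchanged. -/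
theorem blockLoad_update_of_ne {n k : ℕ} {E : Fin k → Type*}
    [∀ j, Fintype (E j)] [∀ j, DecidableEq (E j)]
    (σ : Fin n → ∀ j, E j) {j l : Fin k} (h : l ≠ j) (τ : Fin n → E j) (e : E l) :
    blockLoad (fun i => Function.update (σ i) j (τ i)) l e = blockLoad σ l e := by
  simp [blockLoad, Function.update_of_ne h]

/-- If `σ` is a strong equilibrium of a symmetric capacitated cost-sharing game on a
series of `k` parallel-edge blocks, then for every block `j` the induced profile
`fun i => σ i j` is a strong equilibrium of the symmetric capacitated cost-sharing
game on parallel edges given by block `j`. -/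
theorem strong_equilibrium_induces_blockwise_strong_equilibrium
    {n k : ℕ} (hn : 1 ≤ n) (hk : 1 ≤ k)
    {E : Fin k → Type*} [∀ j, Fintype (E j)] [∀ j, DecidableEq (E j)] [∀ j, Nonempty (E j)]
    (p : ∀ j, E j → ℝ) (hp : ∀ j e, 0 ≤ p j e) (c : ∀ j, E j → ℕ)
    (σ : Fin n → ∀ j, E j) (hσ : IsStrongEqB p c σ) (j : Fin k) :
    IsStrongEqP (p j) (c j) (fun i => σ i j) := by
  refine ⟨fun e => hσ.1 j e, ?_⟩
  rintro ⟨C, τ, hC, hτ, hout, hlt⟩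
  refine hσ.2 ⟨C, fun i => Function.update (σ i) j (τ i), hC, fun l e => ?_, fun i hi => ?_,
    fun i hi => ?_⟩
  · by_cases h : l = j
    · subst h
      rw [blockLoad_update_self]
      exact hτ e
    · rw [blockLoad_update_of_ne σ h]
      exact hσ.1 l e
  · simp [hout i hi]
  · refine Finset.sum_lt_sum (fun l _ => ?_) ⟨j, Finset.mem_univ j, ?_⟩
    · by_cases h : l = j
      · subst h
        simp only [blockLoad_update_self, Function.update_self]
        exact (hlt i hi).le
      · simp only [blockLoad_update_of_ne σ h, Function.update_of_ne h, le_refl]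
    · simp only [blockLoad_update_self, Function.update_self]
      exact hlt i hi
end

section
/- Let σ be a strong equilibrium of a feasible symmetric capacitated cost-sharing game on parallel edges. Then there exists a feasible profile σ* whose social cost is minimal among all feasible profiles, such that for every set C ⊆ Fin n of agents, the combined profile that plays σ* i for i ∈ C and σ i for i ∉ C is feasible. -/
/-- Relabelling the agents does not change the load of an edge. -/
lemma edgeLoad_comp_perm {n : ℕ} {E : Type*} [Fintype E] [DecidableEq E]
    (τ : Fin n → E) (π : Equiv.Perm (Fin n)) (e : E) :
    edgeLoad (τ ∘ π) e = edgeLoad τ e := by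
  unfold edgeLoad
  refine Finset.card_bij (fun i _ => π i) (by simp) (fun _ _ _ _ h => π.injective h) ?_
  intro j hj
  exact ⟨π.symm j, by simpa using hj, by simp⟩

/-- Relabelling the agents does not change the social cost. -/
lemma socialCostP_comp_perm {n : ℕ} {E : Type*} [Fintype E] [DecidableEq E]
    (p : E → ℝ) (τ : Fin n → E) (π : Equiv.Perm (Fin n)) :
    socialCostP p (τ ∘ π) = socialCostP p τ := by
  unfold socialCostP agentCostP
  simp only [edgeLoad_comp_perm, Function.comp_apply]
  exact Equiv.sum_comp π fun i => p (τ i) / (edgeLoad τ (τ i) : ℝ)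

/-- The agents of `τ` can be relabelled so that, on every edge, the sets of users under `σ`
and under the relabelled profile are nested. -/
lemma exists_perm_users_nested {n : ℕ} {E : Type*} [DecidableEq E] (σ τ : Fin n → E) :
    ∃ π : Equiv.Perm (Fin n), ∀ e,
      (∀ i, σ i = e → τ (π i) = e) ∨ ∀ i, τ (π i) = e → σ i = e := by
  obtain ⟨π, hπ⟩ := Finite.exists_max fun π : Equiv.Perm (Fin n) =>
    (Finset.univ.filter fun i => τ (π i) = σ i).card
  refine ⟨π, fun e => ?_⟩
  by_contra! h
  obtain ⟨⟨i, hi, hi'⟩, j, hj, hj'⟩ := h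
  refine (hπ (Equiv.swap i j |>.trans π)).not_gt (Finset.card_lt_card ?_)
  rw [Finset.ssubset_iff_of_subset]
  · exact ⟨i, Finset.mem_filter.2 ⟨Finset.mem_univ _, by simp [hi, hj]⟩, by simp [hi, hi']⟩
  · intro k hk
    have hki : k ≠ i := by
      rintro rfl
      simp_all
    have hkj : k ≠ j := by
      rintro rfl
      simp_all
    exact Finset.mem_filter.2
      ⟨Finset.mem_univ _, by simpa [Equiv.swap_apply_of_ne_of_ne hki hkj] using hk⟩

/-- For every strong equilibrium `σ` of a feasible symmetric capacitated cost-sharing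
game on parallel edges, there is a socially optimal feasible profile `σ*` such that
for every coalition `C`, the combined profile playing `σ*` inside `C` and `σ` outside
`C` is feasible. -/
theorem exists_optimal_profile_combinable_with_SE
    {n : ℕ} (hn : 1 ≤ n) {E : Type*} [Fintype E] [DecidableEq E] [Nonempty E]
    (p : E → ℝ) (hp : ∀ e, 0 ≤ p e) (c : E → ℕ)
    (σ : Fin n → E) (hσ : IsStrongEqP p c σ) :
    ∃ σstar : Fin n → E, FeasibleP c σstar ∧
      (∀ τ : Fin n → E, FeasibleP c τ → socialCostP p σstar ≤ socialCostP p τ) ∧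
      ∀ C : Finset (Fin n), FeasibleP c (fun i => if i ∈ C then σstar i else σ i) := by
  classical
  obtain ⟨⟨τ, hτ⟩, hmin⟩ := @Finite.exists_min {τ : Fin n → E // FeasibleP c τ} _ _ ⟨σ, hσ.1⟩ _
    fun τ => socialCostP p τ.1
  obtain ⟨π, hπ⟩ := exists_perm_users_nested σ τ
  have hfeas : FeasibleP c (τ ∘ π) := fun e => (edgeLoad_comp_perm τ π e).trans_le (hτ e)
  refine ⟨τ ∘ π, hfeas, fun ρ hρ => ?_, fun C e => ?_⟩
  · rw [socialCostP_comp_perm]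
    exact hmin ⟨ρ, hρ⟩
  · rcases hπ e with h | h
    · refine le_trans (Finset.card_le_card fun i hi => ?_) (hfeas e)
      simp only [Finset.mem_filter, Finset.mem_univ, true_and, Function.comp_apply] at hi ⊢
      split_ifs at hi
      exacts [hi, h i hi]
    · refine le_trans (Finset.card_le_card fun i hi => ?_) (hσ.1 e)
      simp only [Finset.mem_filter, Finset.mem_univ, true_and, Function.comp_apply] at hi ⊢
      split_ifs at hi
      exacts [h i hi, hi]
end

section
/- Let s be a strong equilibrium of a capacitated fair cost-sharing congestion game with n agents, and let s* be a feasible profile such that for every set C of agents, the combined profile that plays s*_i for i ∈ C and s_i for i ∉ C is feasible. Then the social cost of s is at most the sum over all resources e of p e · H_{x_e(s*)}, where H_m = 1 + 1/2 + … + 1/m (and H_0 = 0). -/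
/-- The `m`-th harmonic number `1 + 1/2 + ⋯ + 1/m` (with value `0` at `m = 0`). -/
noncomputable def harmonicReal (m : ℕ) : ℝ :=
  ∑ i ∈ Finset.range m, (1 : ℝ) / (i + 1)

/-- The number of members of `C` whose strategy contains `e`. -/
def coalitionLoad {n : ℕ} {E : Type*} [DecidableEq E]
    (t : Fin n → Finset E) (C : Finset (Fin n)) (e : E) : ℕ :=
  (C.filter fun i => e ∈ t i).card

theorem harmonicReal_succ (m : ℕ) :
    harmonicReal (m + 1) = harmonicReal m + 1 / ((m : ℝ) + 1) :=
  Finset.sum_range_succ _ _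

theorem coalitionLoad_le_resLoad {n : ℕ} {E : Type*} [Fintype E] [DecidableEq E]
    (s t : Fin n → Finset E) (C : Finset (Fin n)) (e : E) :
    coalitionLoad t C e ≤ resLoad (fun i => if i ∈ C then t i else s i) e := by
  refine Finset.card_le_card fun i hi => ?_
  obtain ⟨hiC, hie⟩ := Finset.mem_filter.mp hi
  simp [hiC, hie]

/-- Members of a coalition pay at most what they would pay if only the coalition shared
the costs. -/
theorem agentCostC_combined_le {n : ℕ} {E : Type*} [Fintype E] [DecidableEq E]
    (p : E → ℝ) (hp : ∀ e, 0 ≤ p e) (s t : Fin n → Finset E) (C : Finset (Fin n))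
    {i : Fin n} (hi : i ∈ C) :
    agentCostC p (fun j => if j ∈ C then t j else s j) i
      ≤ ∑ e ∈ t i, p e / (coalitionLoad t C e : ℝ) := by
  unfold agentCostC
  simp only [hi, if_true]
  refine Finset.sum_le_sum fun e he => ?_
  have hpos : 0 < coalitionLoad t C e :=
    Finset.card_pos.mpr ⟨i, Finset.mem_filter.mpr ⟨hi, he⟩⟩
  exact div_le_div_of_nonneg_left (hp e) (by exact_mod_cast hpos)
    (by exact_mod_cast coalitionLoad_le_resLoad s t C e)

/-- Removing a member from a coalition lowers the harmonic potential by the member's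
cost within the coalition. -/
theorem sum_harmonicReal_coalitionLoad_erase {n : ℕ} {E : Type*} [Fintype E] [DecidableEq E]
    (p : E → ℝ) (t : Fin n → Finset E) (C : Finset (Fin n)) {i : Fin n} (hi : i ∈ C) :
    ∑ e, p e * harmonicReal (coalitionLoad t C e)
      = ∑ e, p e * harmonicReal (coalitionLoad t (C.erase i) e)
        + ∑ e ∈ t i, p e / (coalitionLoad t C e : ℝ) := by
  rw [← Finset.sum_filter_add_sum_filter_not Finset.univ (fun e => e ∈ t i)
      (fun e => p e * harmonicReal (coalitionLoad t C e)),
    ← Finset.sum_filter_add_sum_filter_not Finset.univ (fun e => e ∈ t i)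
      (fun e => p e * harmonicReal (coalitionLoad t (C.erase i) e))]
  have hnot : ∀ e ∈ Finset.univ.filter (fun e => ¬ e ∈ t i),
      p e * harmonicReal (coalitionLoad t C e)
        = p e * harmonicReal (coalitionLoad t (C.erase i) e) := by
    intro e he
    have he' : e ∉ t i := (Finset.mem_filter.mp he).2
    simp [coalitionLoad, Finset.filter_erase, he']
  have hmem : ∀ e ∈ t i, p e * harmonicReal (coalitionLoad t C e)
      = p e * harmonicReal (coalitionLoad t (C.erase i) e)
        + p e / (coalitionLoad t C e : ℝ) := by
    intro e he
    have hcard : coalitionLoad t C e = coalitionLoad t (C.erase i) e + 1 := by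
      unfold coalitionLoad
      rw [Finset.filter_erase,
        Finset.card_erase_add_one (Finset.mem_filter.mpr ⟨hi, he⟩)]
    rw [hcard, harmonicReal_succ]
    push_cast
    ring
  rw [Finset.sum_congr rfl hnot, Finset.filter_mem_eq_inter, Finset.univ_inter,
    Finset.sum_congr rfl hmem, Finset.sum_add_distrib]
  ring

/-- The members of a coalition together pay at most its harmonic potential. -/
theorem IsStrongEqC.sum_agentCostC_le {n : ℕ} {E : Type*} [Fintype E] [DecidableEq E]
    {St : Fin n → Set (Finset E)} {p : E → ℝ} (hp : ∀ e, 0 ≤ p e) {c : E → ℕ}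
    {s : Fin n → Finset E} (hs : IsStrongEqC St p c s)
    {t : Fin n → Finset E} (ht : ∀ i, t i ∈ St i)
    (hcomb : ∀ C : Finset (Fin n), FeasibleC c (fun i => if i ∈ C then t i else s i))
    (C : Finset (Fin n)) :
    ∑ i ∈ C, agentCostC p s i ≤ ∑ e, p e * harmonicReal (coalitionLoad t C e) := by
  induction C using Finset.strongInduction with
  | H C ih =>
    rcases C.eq_empty_or_nonempty with rfl | hC
    · simp [coalitionLoad, harmonicReal]
    obtain ⟨i, hi, hle⟩ : ∃ i ∈ C,
        agentCostC p s i ≤ agentCostC p (fun j => if j ∈ C then t j else s j) i := by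
      by_contra! h
      refine hs.2.2 ⟨C, _, hC, fun i => ?_, hcomb C, fun i hi => if_neg hi, h⟩
      split_ifs
      exacts [ht i, hs.1 i]
    rw [sum_harmonicReal_coalitionLoad_erase p t C hi, ← Finset.sum_erase_add C _ hi]
    exact add_le_add (ih _ (Finset.erase_ssubset hi))
      (hle.trans (agentCostC_combined_le p hp s t C hi))

/-- Let `s` be a strong equilibrium of a capacitated fair cost-sharing congestion game
and let `s*` be a feasible profile such that for every coalition `C` the combined
profile playing `s*` inside `C` and `s` outside `C` is feasible. Then the social cost
of `s` is at most `∑_e p e · H_{x_e(s*)}`. -/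
theorem SE_cost_le_sum_harmonic_of_combinable_profile
    {n : ℕ} (hn : 1 ≤ n) {E : Type*} [Fintype E] [DecidableEq E]
    (St : Fin n → Set (Finset E)) (hSt : ∀ i, (St i).Nonempty)
    (p : E → ℝ) (hp : ∀ e, 0 ≤ p e) (c : E → ℕ)
    (s : Fin n → Finset E) (hs : IsStrongEqC St p c s)
    (sstar : Fin n → Finset E) (hstarSt : ∀ i, sstar i ∈ St i)
    (hstar : FeasibleC c sstar)
    (hcomb : ∀ C : Finset (Fin n), FeasibleC c (fun i => if i ∈ C then sstar i else s i)) :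
    socialCostC p s ≤ ∑ e, p e * harmonicReal (resLoad sstar e) := by
  exact hs.sum_agentCostC_le hp hstarSt hcomb Finset.univ
end

section
/- In a feasible symmetric capacitated cost-sharing game on parallel edges in which all edges have the same capacity c (homogeneous capacities), every strong equilibrium has minimal social cost: for every strong equilibrium σ and every feasible profile τ, the social cost of σ is at most the social cost of τ. In particular, the strong price of anarchy equals 1. -/
section ParallelEdges

variable {n : ℕ} {E : Type*} [Fintype E] [DecidableEq E]

theorem edgeLoad_pos_iff {σ : Fin n → E} {e : E} :
    0 < edgeLoad σ e ↔ e ∈ Finset.univ.image σ := by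
  simp [edgeLoad, Finset.card_pos, Finset.Nonempty]

theorem sum_edgeLoad_image (σ : Fin n → E) :
    ∑ e ∈ Finset.univ.image σ, edgeLoad σ e = n := by
  have h := Finset.card_eq_sum_card_image σ Finset.univ
  simpa [edgeLoad] using h.symm

theorem socialCostP_eq_sum_image (p : E → ℝ) (σ : Fin n → E) :
    socialCostP p σ = ∑ e ∈ Finset.univ.image σ, p e := by
  unfold socialCostP
  rw [← Finset.sum_fiberwise_of_maps_to (t := Finset.univ.image σ) (g := σ) (by simp)]
  refine Finset.sum_congr rfl fun e he => ?_
  have hpos : (edgeLoad σ e : ℝ) ≠ 0 := by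
    exact_mod_cast (edgeLoad_pos_iff.2 he).ne'
  have hconst : ∀ i ∈ Finset.univ.filter (fun i => σ i = e),
      agentCostP p σ i = p e / (edgeLoad σ e : ℝ) := by
    intro i hi
    rw [agentCostP, (Finset.mem_filter.1 hi).2]
  rw [Finset.sum_congr rfl hconst, Finset.sum_const, nsmul_eq_mul]
  exact mul_div_cancel₀ (p e) hpos

/-- If all users of a used edge may jointly move to an unused edge, the unused edge is at
least as expensive. -/
theorem IsStrongEqP.le_of_unused {p : E → ℝ} {c : E → ℕ} {σ : Fin n → E}
    (hσ : IsStrongEqP p c σ) {e f : E} (he : edgeLoad σ e = 0) (hf : 0 < edgeLoad σ f)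
    (hcap : edgeLoad σ f ≤ c e) : p f ≤ p e := by
  by_contra! hlt
  have hun : ∀ i, σ i ≠ e := by
    simpa [edgeLoad, Finset.filter_eq_empty_iff] using he
  let σ' : Fin n → E := fun i => if σ i = f then e else σ i
  have hload : edgeLoad σ' e = edgeLoad σ f := by
    unfold edgeLoad
    congr 1
    ext i
    have := hun i
    by_cases h : σ i = f <;> simp [σ', h, this]
  refine hσ.2 ⟨Finset.univ.filter fun i => σ i = f, σ', Finset.card_pos.1 hf, ?_, ?_, ?_⟩
  · intro g
    by_cases hg : g = e
    · rw [hg, hload]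
      exact hcap
    · refine le_trans (Finset.card_le_card fun i hi => ?_) (hσ.1 g)
      by_cases h : σ i = f
      · simp [σ', h, Ne.symm hg] at hi
      · simpa [σ', h] using hi
  · intro i hi
    have h : σ i ≠ f := by simpa using hi
    simp [σ', h]
  · intro i hi
    have h : σ i = f := by simpa using hi
    have h' : σ' i = e := by simp [σ', h]
    rw [agentCostP, agentCostP, h, h', hload]
    exact div_lt_div_of_pos_right hlt (by exact_mod_cast hf)

/-- No single agent gains by moving to another edge with residual capacity. -/
theorem IsStrongEqP.div_le_div_succ {p : E → ℝ} {c : E → ℕ} {σ : Fin n → E}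
    (hσ : IsStrongEqP p c σ) {e f : E} (hne : e ≠ f) (he : edgeLoad σ e < c e)
    (hf : 0 < edgeLoad σ f) :
    p f / (edgeLoad σ f : ℝ) ≤ p e / ((edgeLoad σ e : ℝ) + 1) := by
  by_contra! hlt
  obtain ⟨i, hi⟩ := Finset.card_pos.1 hf
  have hif : σ i = f := by simpa using hi
  let σ' : Fin n → E := Function.update σ i e
  have hload : edgeLoad σ' e = edgeLoad σ e + 1 := by
    unfold edgeLoad
    rw [← Finset.card_insert_of_notMem (a := i) (by simp [hif, Ne.symm hne])]
    congr 1
    ext j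
    by_cases h : j = i <;> simp [σ', h]
  refine hσ.2 ⟨{i}, σ', by simp, ?_, ?_, ?_⟩
  · intro g
    by_cases hg : g = e
    · rw [hg, hload]
      exact he
    · refine le_trans (Finset.card_le_card fun j hj => ?_) (hσ.1 g)
      by_cases h : j = i
      · simp [σ', h, Ne.symm hg] at hj
      · simpa [σ', h] using hj
  · intro j hj
    have h : j ≠ i := by simpa using hj
    simp [σ', h]
  · intro j hj
    have h : j = i := by simpa using hj
    have h' : σ' i = e := by simp [σ']
    rw [h, agentCostP, agentCostP, hif, h', hload]
    exact_mod_cast hlt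

/-- In a strong equilibrium, a used edge with residual capacity has a strictly larger share
than any other used edge of positive cost. -/
theorem IsStrongEqP.div_lt_div {p : E → ℝ} {c : E → ℕ} {σ : Fin n → E}
    (hσ : IsStrongEqP p c σ) {e f : E} (hne : e ≠ f) (he : edgeLoad σ e < c e)
    (he0 : 0 < edgeLoad σ e) (hf : 0 < edgeLoad σ f) (hpf : 0 < p f) :
    p f / (edgeLoad σ f : ℝ) < p e / (edgeLoad σ e : ℝ) := by
  have h := hσ.div_le_div_succ hne he hf
  have hf' : (0 : ℝ) < edgeLoad σ f := by exact_mod_cast hf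
  have he' : (0 : ℝ) < edgeLoad σ e := by exact_mod_cast he0
  have hpe : 0 < p e := by
    have := (div_pos hpf hf').trans_le h
    exact (div_pos_iff_of_pos_right (by linarith)).1 this
  exact h.trans_lt (div_lt_div_of_pos_left hpe he' (by linarith))

/-- In a strong equilibrium that uses an edge of positive cost, at most one used edge has
residual capacity. -/
theorem IsStrongEqP.eq_of_load_lt {p : E → ℝ} (hp : ∀ e, 0 ≤ p e) {c : E → ℕ}
    {σ : Fin n → E} (hσ : IsStrongEqP p c σ) {g : E} (hg : 0 < edgeLoad σ g)
    (hpg : 0 < p g) {e f : E} (he : edgeLoad σ e < c e) (he0 : 0 < edgeLoad σ e)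
    (hf : edgeLoad σ f < c f) (hf0 : 0 < edgeLoad σ f) : e = f := by
  have key : ∀ a, edgeLoad σ a < c a → 0 < edgeLoad σ a → 0 < p a := by
    intro a ha ha0
    by_cases hag : a = g
    · rwa [hag]
    · have h := hσ.div_lt_div hag ha ha0 hg hpg
      have h' := (div_nonneg (hp g) (Nat.cast_nonneg (edgeLoad σ g))).trans_lt h
      exact (div_pos_iff_of_pos_right (by exact_mod_cast ha0)).1 h'
  by_contra hne
  exact lt_asymm (hσ.div_lt_div hne he he0 hf0 (key f hf hf0))
    (hσ.div_lt_div (Ne.symm hne) hf hf0 he0 (key e he he0))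

end ParallelEdges

/-- A finite set of elements of smallest weight has weight at most that of any set that is at
least as large. -/
theorem Finset.sum_le_sum_of_card_le_of_forall_le {ι : Type*} [DecidableEq ι] {p : ι → ℝ}
    (hp : ∀ i, 0 ≤ p i) {A B : Finset ι} (hcard : A.card ≤ B.card)
    (hle : ∀ a ∈ A, ∀ b, b ∉ A → p a ≤ p b) : ∑ i ∈ A, p i ≤ ∑ i ∈ B, p i := by
  have hcard' : (A \ B).card ≤ (B \ A).card := Finset.card_sdiff_le_card_sdiff_iff.2 hcard
  have hdiff : ∑ i ∈ A \ B, p i ≤ ∑ i ∈ B \ A, p i := by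
    rcases (A \ B).eq_empty_or_nonempty with h | h
    · rw [h, Finset.sum_empty]
      exact Finset.sum_nonneg fun i _ => hp i
    · obtain ⟨m, hm, hmax⟩ := Finset.exists_max_image (A \ B) p h
      calc ∑ i ∈ A \ B, p i ≤ (A \ B).card • p m := Finset.sum_le_card_nsmul _ _ _ hmax
        _ ≤ (B \ A).card • p m := nsmul_le_nsmul_left (hp m) hcard'
        _ ≤ ∑ i ∈ B \ A, p i := Finset.card_nsmul_le_sum _ _ _ fun b hb =>
          hle m (Finset.mem_sdiff.1 hm).1 b (Finset.mem_sdiff.1 hb).2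
  rw [← Finset.sum_inter_add_sum_sdiff A B p, ← Finset.sum_inter_add_sum_sdiff B A p,
    Finset.inter_comm B A]
  linarith

/-- In a feasible symmetric capacitated cost-sharing game on parallel edges with
homogeneous capacities, every strong equilibrium has minimal social cost; in particular
the strong price of anarchy equals `1`. -/
theorem parallel_edges_homogeneous_SE_optimal
    {n : ℕ} (hn : 1 ≤ n) {E : Type*} [Fintype E] [DecidableEq E] [Nonempty E]
    (p : E → ℝ) (hp : ∀ e, 0 ≤ p e) (c : E → ℕ)
    (cc : ℕ) (hc : ∀ e, c e = cc)
    (σ : Fin n → E) (hσ : IsStrongEqP p c σ)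
    (τ : Fin n → E) (hτ : FeasibleP c τ) :
    socialCostP p σ ≤ socialCostP p τ := by
  rw [socialCostP_eq_sum_image, socialCostP_eq_sum_image]
  by_cases hzero : ∀ e ∈ Finset.univ.image σ, p e = 0
  · rw [Finset.sum_eq_zero hzero]
    exact Finset.sum_nonneg fun e _ => hp e
  push Not at hzero
  obtain ⟨g, hg, hpg⟩ := hzero
  have hpg' : 0 < p g := lt_of_le_of_ne (hp g) (Ne.symm hpg)
  refine Finset.sum_le_sum_of_card_le_of_forall_le hp ?_ ?_
  · have hfull : ∃ e₀ ∈ Finset.univ.image σ, ∀ e ∈ (Finset.univ.image σ).erase e₀,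
        cc ≤ edgeLoad σ e := by
      by_cases h : ∃ e₀ ∈ Finset.univ.image σ, edgeLoad σ e₀ < cc
      · obtain ⟨e₀, he₀, hlt⟩ := h
        refine ⟨e₀, he₀, fun e he => ?_⟩
        by_contra! hlt'
        exact Finset.ne_of_mem_erase he (hσ.eq_of_load_lt hp (edgeLoad_pos_iff.2 hg) hpg'
          (by rwa [hc]) (edgeLoad_pos_iff.2 (Finset.mem_of_mem_erase he))
          (by rwa [hc]) (edgeLoad_pos_iff.2 he₀))
      · push Not at h
        exact ⟨g, hg, fun e he => h e (Finset.mem_of_mem_erase he)⟩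
    obtain ⟨e₀, he₀, hfull⟩ := hfull
    have hlower : ((Finset.univ.image σ).card - 1) * cc < n := by
      have h := Finset.card_nsmul_le_sum _ (fun e => edgeLoad σ e) _ hfull
      rw [Finset.card_erase_of_mem he₀, smul_eq_mul] at h
      have hsum := Finset.add_sum_erase _ (fun e => edgeLoad σ e) he₀
      rw [sum_edgeLoad_image] at hsum
      have hpos := edgeLoad_pos_iff.2 he₀
      omega
    have hupper : n ≤ (Finset.univ.image τ).card * cc := by
      rw [← smul_eq_mul]
      calc n = ∑ e ∈ Finset.univ.image τ, edgeLoad τ e := (sum_edgeLoad_image τ).symm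
        _ ≤ _ := Finset.sum_le_card_nsmul _ _ _ fun e _ => (hτ e).trans_eq (hc e)
    have hlt := lt_of_mul_lt_mul_right (hlower.trans_le hupper) (Nat.zero_le cc)
    omega
  · intro f hf e he
    refine hσ.le_of_unused (Nat.eq_zero_of_not_pos fun h => he (edgeLoad_pos_iff.1 h))
      (edgeLoad_pos_iff.2 hf) ?_
    rw [hc e, ← hc f]
    exact hσ.1 f
end

section
/- In a feasible symmetric capacitated cost-sharing game on a series of k parallel-edge blocks in which all edges of all blocks have the same capacity c (homogeneous capacities), every strong equilibrium has minimal social cost: for every strong equilibrium σ and every feasible profile τ, the social cost of σ is at most the social cost of τ. -/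
section

variable {n k : ℕ} {E : Fin k → Type*} [∀ j, Fintype (E j)] [∀ j, DecidableEq (E j)]
  {p : ∀ j, E j → ℝ} {c : ∀ j, E j → ℕ} {σ τ : Fin n → ∀ j, E j}

theorem blockLoad_pos_iff {j : Fin k} {e : E j} :
    0 < blockLoad σ j e ↔ e ∈ Finset.univ.image (σ · j) := by
  simp [blockLoad, Finset.card_pos, Finset.Nonempty]

theorem sum_blockLoad_image (σ : Fin n → ∀ j, E j) (j : Fin k) :
    ∑ e ∈ Finset.univ.image (σ · j), blockLoad σ j e = n := by
  simpa [blockLoad] using (Finset.card_eq_sum_card_image (σ · j) Finset.univ).symm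

/-- The social cost is the total cost of the edges in use. -/
theorem socialCostB_eq_sum_image (p : ∀ j, E j → ℝ) (σ : Fin n → ∀ j, E j) :
    socialCostB p σ = ∑ j, ∑ e ∈ Finset.univ.image (σ · j), p j e := by
  unfold socialCostB agentCostB
  rw [Finset.sum_comm]
  refine Finset.sum_congr rfl fun j _ => ?_
  rw [Finset.sum_comp (fun e => p j e / (blockLoad σ j e : ℝ)) (σ · j)]
  refine Finset.sum_congr rfl fun e he => ?_
  have h : (blockLoad σ j e : ℝ) ≠ 0 := by
    exact_mod_cast (blockLoad_pos_iff.2 he).ne'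
  rw [nsmul_eq_mul]
  exact mul_div_cancel₀ _ h

/-- The profile in which the agents of `S` switch to edge `f` in block `j`. -/
def switchEdge (σ : Fin n → ∀ j, E j) (S : Finset (Fin n)) (j : Fin k) (f : E j) :
    Fin n → ∀ j, E j :=
  fun i => if i ∈ S then Function.update (σ i) j f else σ i

theorem blockLoad_switchEdge_of_ne (S : Finset (Fin n)) {j l : Fin k} (f : E j) (h : l ≠ j)
    (e : E l) : blockLoad (switchEdge σ S j f) l e = blockLoad σ l e := by
  unfold blockLoad switchEdge
  congr 1
  ext i
  by_cases hi : i ∈ S <;> simp [hi, h]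

theorem blockLoad_switchEdge_le (S : Finset (Fin n)) {j : Fin k} {e f : E j} (h : e ≠ f) :
    blockLoad (switchEdge σ S j f) j e ≤ blockLoad σ j e := by
  refine Finset.card_le_card fun i => ?_
  rw [Finset.mem_filter, Finset.mem_filter]
  by_cases hi : i ∈ S <;> simp [switchEdge, hi, h.symm]

theorem blockLoad_switchEdge_self {S : Finset (Fin n)} {j : Fin k} {f : E j}
    (h : ∀ i ∈ S, σ i j ≠ f) :
    blockLoad (switchEdge σ S j f) j f = blockLoad σ j f + S.card := by
  unfold blockLoad
  rw [← Finset.card_union_of_disjoint]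
  · congr 1
    ext i
    rw [Finset.mem_union, Finset.mem_filter, Finset.mem_filter]
    by_cases hi : i ∈ S <;> simp [switchEdge, hi]
  · rw [Finset.disjoint_left]
    intro i hi hS
    exact h i hS (Finset.mem_filter.1 hi).2

/-- In a strong equilibrium, users of `e` cannot gain by moving together to an edge `f` of the
same block that can accommodate them. -/
theorem IsStrongEqB.div_blockLoad_le (hσ : IsStrongEqB p c σ) {j : Fin k} {e f : E j}
    (hef : e ≠ f) {S : Finset (Fin n)} (hS : S.Nonempty) (hSe : ∀ i ∈ S, σ i j = e)
    (hcap : blockLoad σ j f + S.card ≤ c j f) :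
    p j e / (blockLoad σ j e : ℝ) ≤ p j f / ((blockLoad σ j f + S.card : ℕ) : ℝ) := by
  by_contra! hlt
  have hself : blockLoad (switchEdge σ S j f) j f = blockLoad σ j f + S.card :=
    blockLoad_switchEdge_self fun i hi => by rw [hSe i hi]; exact hef
  refine hσ.2 ⟨S, switchEdge σ S j f, hS, fun l d => ?_, fun i hi => by simp [switchEdge, hi],
    fun i hi => ?_⟩
  · by_cases hl : l = j
    · subst hl
      by_cases hd : d = f
      · subst hd
        rwa [hself]
      · exact (blockLoad_switchEdge_le S hd).trans (hσ.1 l d)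
    · rw [blockLoad_switchEdge_of_ne S f hl]
      exact hσ.1 l d
  · have hj : switchEdge σ S j f i j = f := by simp [switchEdge, hi]
    have hne : ∀ l ≠ j, switchEdge σ S j f i l = σ i l := fun l hl => by
      simp [switchEdge, hi, hl]
    refine Finset.sum_lt_sum (fun l _ => ?_) ⟨j, Finset.mem_univ j, ?_⟩
    · by_cases hl : l = j
      · subst hl
        rw [hj, hself, hSe i hi]
        exact hlt.le
      · rw [hne l hl, blockLoad_switchEdge_of_ne S f hl]
    · rw [hj, hself, hSe i hi]
      exact hlt

/-- In a strong equilibrium, a user of `e` cannot gain by moving to a non-full edge `f`. -/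
theorem IsStrongEqB.div_blockLoad_le_succ (hσ : IsStrongEqB p c σ) {j : Fin k} {e f : E j}
    (hef : e ≠ f) (he : e ∈ Finset.univ.image (σ · j)) (hf : blockLoad σ j f < c j f) :
    p j e / (blockLoad σ j e : ℝ) ≤ p j f / ((blockLoad σ j f + 1 : ℕ) : ℝ) := by
  obtain ⟨i, -, hi⟩ := Finset.mem_image.1 he
  simpa using hσ.div_blockLoad_le hef (Finset.singleton_nonempty i)
    (by simpa using hi) (by simpa using hf)

/-- Under homogeneous capacities, no unused edge of a block is cheaper than a used one. -/
theorem IsStrongEqB.cost_le_of_notMem_image (hσ : IsStrongEqB p c σ) {cc : ℕ}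
    (hc : ∀ j e, c j e = cc) {j : Fin k} {e f : E j}
    (he : e ∈ Finset.univ.image (σ · j)) (hf : f ∉ Finset.univ.image (σ · j)) :
    p j e ≤ p j f := by
  have hpos := blockLoad_pos_iff.2 he
  have hf0 : blockLoad σ j f = 0 := by
    by_contra h
    exact hf (blockLoad_pos_iff.1 (Nat.pos_of_ne_zero h))
  have hle := hσ.1 j e
  have hcap : blockLoad σ j f + blockLoad σ j e ≤ c j f := by
    rw [hc] at hle ⊢
    omega
  have key := hσ.div_blockLoad_le (ne_of_mem_of_not_mem he hf)
    (S := Finset.univ.filter fun i => σ i j = e) (Finset.card_pos.1 hpos)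
    (fun i hi => (Finset.mem_filter.1 hi).2) hcap
  change p j e / (blockLoad σ j e : ℝ) ≤
    p j f / ((blockLoad σ j f + blockLoad σ j e : ℕ) : ℝ) at key
  rw [hf0, zero_add] at key
  exact (div_le_div_iff_of_pos_right (by exact_mod_cast hpos)).1 key

/-- In a block where some used edge has positive cost, at most one used edge is not full. -/
theorem IsStrongEqB.eq_of_blockLoad_lt (hσ : IsStrongEqB p c σ) (hp : ∀ j e, 0 ≤ p j e)
    {j : Fin k} {d f g : E j} (hd : d ∈ Finset.univ.image (σ · j)) (hpd : 0 < p j d)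
    (hf : f ∈ Finset.univ.image (σ · j)) (hg : g ∈ Finset.univ.image (σ · j))
    (hfc : blockLoad σ j f < c j f) (hgc : blockLoad σ j g < c j g) : f = g := by
  by_contra hne
  have hload : ∀ {e : E j}, e ∈ Finset.univ.image (σ · j) → (0 : ℝ) < blockLoad σ j e :=
    fun he => by exact_mod_cast blockLoad_pos_iff.2 he
  have hfg := hσ.div_blockLoad_le_succ hne hf hgc
  have hgf := hσ.div_blockLoad_le_succ (Ne.symm hne) hg hfc
  have hf0 := hload hf
  have hg0 := hload hg
  have hpg : p j g = 0 := by
    push_cast at hfg hgf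
    have hmono : p j f / ((blockLoad σ j f : ℝ) + 1) ≤ p j f / (blockLoad σ j f : ℝ) :=
      div_le_div_of_nonneg_left (hp j f) hf0 (by linarith)
    have h := hgf.trans (hmono.trans hfg)
    rw [div_le_div_iff₀ hg0 (by linarith)] at h
    have := hp j g
    linarith
  have hdg : d ≠ g := by
    rintro rfl
    exact hpd.ne' hpg
  have h := hσ.div_blockLoad_le_succ hdg hd hgc
  rw [hpg, zero_div] at h
  exact absurd h (not_le.2 (div_pos hpd (hload hd)))

/-- Under homogeneous capacities, a strong equilibrium in which some used edge of block `j` has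
positive cost uses as few edges of that block as possible. -/
theorem IsStrongEqB.card_image_le (hσ : IsStrongEqB p c σ) (hp : ∀ j e, 0 ≤ p j e) {cc : ℕ}
    (hc : ∀ j e, c j e = cc) (hτ : FeasibleB c τ) {j : Fin k} {d : E j}
    (hd : d ∈ Finset.univ.image (σ · j)) (hpd : 0 < p j d) :
    (Finset.univ.image (σ · j)).card ≤ (Finset.univ.image (τ · j)).card := by
  obtain ⟨f, hf, hfull⟩ : ∃ f ∈ Finset.univ.image (σ · j),
      ∀ e ∈ (Finset.univ.image (σ · j)).erase f, cc ≤ blockLoad σ j e := by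
    by_cases h : ∃ f ∈ Finset.univ.image (σ · j), blockLoad σ j f < cc
    · obtain ⟨f, hf, hfc⟩ := h
      refine ⟨f, hf, fun e he => ?_⟩
      by_contra! hec
      obtain ⟨hne, he⟩ := Finset.mem_erase.1 he
      exact hne (hσ.eq_of_blockLoad_lt hp hd hpd he hf (by rwa [hc]) (by rwa [hc]))
    · push Not at h
      exact ⟨d, hd, fun e he => h e (Finset.mem_of_mem_erase he)⟩
  have hlower := Finset.card_nsmul_le_sum _ (blockLoad σ j) _ hfull
  have hupper := Finset.sum_le_card_nsmul (Finset.univ.image (τ · j)) (blockLoad τ j) cc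
    fun e _ => (hτ j e).trans_eq (hc j e)
  have hsplit := Finset.add_sum_erase _ (blockLoad σ j) hf
  rw [sum_blockLoad_image] at hupper hsplit
  rw [Finset.card_erase_of_mem hf, smul_eq_mul] at hlower
  rw [smul_eq_mul] at hupper
  have hpos := blockLoad_pos_iff.2 hf
  have hlt_n := (Nat.lt_add_of_pos_left hpos).trans_eq hsplit
  have hlt := Nat.lt_of_mul_lt_mul_right (hlower.trans_lt (hlt_n.trans_le hupper))
  omega

/-- Under homogeneous capacities, a strong equilibrium minimises the total cost of the used edges
in each block. -/
theorem IsStrongEqB.sum_image_le (hσ : IsStrongEqB p c σ) (hp : ∀ j e, 0 ≤ p j e) {cc : ℕ}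
    (hc : ∀ j e, c j e = cc) (hτ : FeasibleB c τ) (j : Fin k) :
    ∑ e ∈ Finset.univ.image (σ · j), p j e ≤ ∑ e ∈ Finset.univ.image (τ · j), p j e := by
  by_cases h : ∃ d ∈ Finset.univ.image (σ · j), 0 < p j d
  · obtain ⟨d, hd, hpd⟩ := h
    have hcard := hσ.card_image_le hp hc hτ hd hpd
    have hsep : ∀ e ∈ Finset.univ.image (σ · j), ∀ f ∉ Finset.univ.image (σ · j),
        p j e ≤ p j f := fun e he f hf => hσ.cost_le_of_notMem_image hc he hf
    generalize Finset.univ.image (σ · j) = U at hcard hsep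
    generalize Finset.univ.image (τ · j) = V at hcard
    rw [← Finset.sum_sdiff_le_sum_sdiff]
    obtain hUV | hUV := (U \ V).eq_empty_or_nonempty
    · rw [hUV, Finset.sum_empty]
      exact Finset.sum_nonneg fun e _ => hp j e
    · obtain ⟨a, ha, hmax⟩ := Finset.exists_max_image _ (p j) hUV
      calc ∑ e ∈ U \ V, p j e ≤ (U \ V).card • p j a := Finset.sum_le_card_nsmul _ _ _ hmax
        _ ≤ (V \ U).card • p j a :=
          nsmul_le_nsmul_left (hp j a) (Finset.card_sdiff_le_card_sdiff_iff.2 hcard)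
        _ ≤ ∑ e ∈ V \ U, p j e := Finset.card_nsmul_le_sum _ _ _ fun f hf =>
          hsep a (Finset.mem_sdiff.1 ha).1 f (Finset.mem_sdiff.1 hf).2
  · push Not at h
    exact (Finset.sum_nonpos h).trans (Finset.sum_nonneg fun e _ => hp j e)

end

/-- In a feasible symmetric capacitated cost-sharing game on a series of `k`
parallel-edge blocks with homogeneous capacities, every strong equilibrium has
minimal social cost. -/
theorem series_of_parallel_blocks_homogeneous_SE_optimal
    {n k : ℕ} (hn : 1 ≤ n) (hk : 1 ≤ k)
    {E : Fin k → Type*} [∀ j, Fintype (E j)] [∀ j, DecidableEq (E j)] [∀ j, Nonempty (E j)]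
    (p : ∀ j, E j → ℝ) (hp : ∀ j e, 0 ≤ p j e) (c : ∀ j, E j → ℕ)
    (cc : ℕ) (hc : ∀ j e, c j e = cc)
    (σ : Fin n → ∀ j, E j) (hσ : IsStrongEqB p c σ)
    (τ : Fin n → ∀ j, E j) (hτ : FeasibleB c τ) :
    socialCostB p σ ≤ socialCostB p τ := by
  rw [socialCostB_eq_sum_image, socialCostB_eq_sum_image]
  exact Finset.sum_le_sum fun j _ => hσ.sum_image_le hp hc hτ j
end

section
/- Let σ be a strong equilibrium of a symmetric capacitated cost-sharing game on parallel edges in which all edges have the same capacity c. Then there do not exist edges e ≠ e' with x_e(σ) > 0, x_{e'}(σ) < c, and p e' < p e; that is, no used edge is strictly more expensive than an edge with residual capacity. -/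
/-- Moving a set of agents `S` to an edge `e'` which none of them uses adds `S.card` to the
load of `e'`. -/
theorem edgeLoad_move_self {n : ℕ} {E : Type*} [Fintype E] [DecidableEq E]
    (σ : Fin n → E) (S : Finset (Fin n)) (e' : E) (hS : ∀ i ∈ S, σ i ≠ e') :
    edgeLoad (fun i => if i ∈ S then e' else σ i) e' = S.card + edgeLoad σ e' := by
  unfold edgeLoad
  rw [← Finset.card_union_of_disjoint]
  · congr 1
    ext i
    by_cases hi : i ∈ S <;> simp [hi]
  · rw [Finset.disjoint_left]
    intro i hi
    simpa using hS i hi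

/-- Moving agents to an edge `e'` does not increase the load of any other edge. -/
theorem edgeLoad_move_le {n : ℕ} {E : Type*} [Fintype E] [DecidableEq E]
    (σ : Fin n → E) (S : Finset (Fin n)) {e' f : E} (hf : f ≠ e') :
    edgeLoad (fun i => if i ∈ S then e' else σ i) f ≤ edgeLoad σ f := by
  unfold edgeLoad
  apply Finset.card_le_card
  intro i
  by_cases hi : i ∈ S <;> simp [hi, hf.symm]

/-- In a strong equilibrium of a symmetric capacitated cost-sharing game on parallel
edges with homogeneous capacities, no used edge is strictly more expensive than an
edge with residual capacity. -/
theorem parallel_edges_homogeneous_SE_no_expensive_used_edge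
    {n : ℕ} (hn : 1 ≤ n) {E : Type*} [Fintype E] [DecidableEq E] [Nonempty E]
    (p : E → ℝ) (hp : ∀ e, 0 ≤ p e) (c : E → ℕ)
    (cc : ℕ) (hc : ∀ e, c e = cc)
    (σ : Fin n → E) (hσ : IsStrongEqP p c σ) :
    ¬ ∃ e e' : E, e ≠ e' ∧ 0 < edgeLoad σ e ∧ edgeLoad σ e' < cc ∧ p e' < p e := by
  rintro ⟨e, e', hne, hpos, hlt, hpe⟩
  obtain ⟨hfeas, hno⟩ := hσ
  have hcap : edgeLoad σ e ≤ cc := hc e ▸ hfeas e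
  obtain ⟨S, hSsub, hScard⟩ :=
    Finset.exists_subset_card_eq (s := Finset.univ.filter fun i => σ i = e)
      (n := min (edgeLoad σ e) (cc - edgeLoad σ e')) (min_le_left _ _)
  have hSe : ∀ i ∈ S, σ i = e := fun i hi => (Finset.mem_filter.mp (hSsub hi)).2
  have hload := edgeLoad_move_self σ S e' fun i hi => (hSe i hi).trans_ne hne
  refine hno ⟨S, fun i => if i ∈ S then e' else σ i, ?_, ?_, ?_, ?_⟩
  · rw [← Finset.card_pos]
    omega
  · intro f
    by_cases hf : f = e'
    · subst hf
      rw [hload, hc]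
      omega
    · exact (edgeLoad_move_le σ S hf).trans (hfeas f)
  · intro i hi
    simp [hi]
  · intro i hi
    have hx : (0 : ℝ) < edgeLoad σ e := by exact_mod_cast hpos
    have hle : (edgeLoad σ e : ℝ) ≤ ((S.card + edgeLoad σ e' : ℕ) : ℝ) := by
      exact_mod_cast (by omega : edgeLoad σ e ≤ S.card + edgeLoad σ e')
    simp only [agentCostP, hi, if_true, hload, hSe i hi]
    calc p e' / ((S.card + edgeLoad σ e' : ℕ) : ℝ) ≤ p e' / edgeLoad σ e :=
          div_le_div_of_nonneg_left (hp e') hx hle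
      _ < p e / edgeLoad σ e := div_lt_div_of_pos_right hpe hx
end

section
/- Fix an integer n ≥ 2 and a real number ε with 0 < ε < 1. Consider the capacitated fair cost-sharing congestion game with n agents and resources: a bypass resource b with cost 1 + ε and capacity 1, and for each k ∈ {1, …, n} two resources z_k (cost 0, capacity n − 1) and o_k (cost 1, capacity n); every agent has the same strategy set consisting of {b} together with all sets that contain exactly one of z_k, o_k for each k ∈ {1, …, n} (and nothing else). Then: (1) the profile in which agent i plays {o_i} ∪ {z_k : k ≠ i} is a strong equilibrium with social cost n; (2) the minimum social cost over all feasible profiles equals 1 + ε. Consequently, the strong price of anarchy of this game is at least n/(1 + ε). -/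
/-- The resources of the example game: a bypass resource (`Sum.inl ()`), and for each
`k ∈ Fin n` a zero-cost resource `z_k = Sum.inr (k, false)` and a unit-cost resource
`o_k = Sum.inr (k, true)`. -/
abbrev ExRes (n : ℕ) := Unit ⊕ (Fin n × Bool)

/-- Costs: the bypass costs `1 + ε`, each `z_k` costs `0`, each `o_k` costs `1`. -/
def pEx13 (n : ℕ) (ε : ℝ) : ExRes n → ℝ
  | Sum.inl _ => 1 + ε
  | Sum.inr (_, false) => 0
  | Sum.inr (_, true) => 1

/-- Capacities: the bypass has capacity `1`, each `z_k` has capacity `n - 1`,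
each `o_k` has capacity `n`. -/
def cEx13 (n : ℕ) : ExRes n → ℕ
  | Sum.inl _ => 1
  | Sum.inr (_, false) => n - 1
  | Sum.inr (_, true) => n

/-- The common strategy set: the bypass alone, or any set containing exactly one of
`z_k, o_k` for each `k` and nothing else. -/
def StEx13 (n : ℕ) : Set (Finset (ExRes n)) :=
  insert {Sum.inl ()}
    { T | ∃ f : Fin n → Bool, T = Finset.univ.image fun k => Sum.inr (k, f k) }

/-- The candidate strong equilibrium: agent `i` plays `{o_i} ∪ {z_k : k ≠ i}`. -/
def sEx13 (n : ℕ) : Fin n → Finset (ExRes n) :=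
  fun i => Finset.univ.image fun k => Sum.inr (k, decide (k = i))

theorem resLoad_pos_of_mem {n : ℕ} {E : Type*} [Fintype E] [DecidableEq E]
    {s : Fin n → Finset E} {e : E} {i : Fin n} (h : e ∈ s i) : 0 < resLoad s e :=
  Finset.card_pos.mpr ⟨i, by simpa using h⟩

/-- The social cost is the total cost of the resources in use. -/
theorem socialCostC_eq_sum_used {n : ℕ} {E : Type*} [Fintype E] [DecidableEq E]
    (p : E → ℝ) (s : Fin n → Finset E) :
    socialCostC p s = ∑ e, if resLoad s e = 0 then 0 else p e := by
  have h : ∀ i, agentCostC p s i = ∑ e, if e ∈ s i then p e / (resLoad s e : ℝ) else 0 := by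
    intro i
    simp [agentCostC]
  simp only [socialCostC, h]
  rw [Finset.sum_comm]
  refine Finset.sum_congr rfl fun e _ => ?_
  rw [← Finset.sum_filter, Finset.sum_const, nsmul_eq_mul]
  change (resLoad s e : ℝ) * _ = _
  split_ifs with h0
  · simp [h0]
  · field_simp

theorem pEx13_nonneg {n : ℕ} {ε : ℝ} (hε : 0 ≤ ε) (e : ExRes n) : 0 ≤ pEx13 n ε e := by
  rcases e with _ | ⟨_, _ | _⟩ <;> simp only [pEx13] <;> linarith

theorem mem_or_mem_of_mem_StEx13 {n : ℕ} {T : Finset (ExRes n)} (hT : T ∈ StEx13 n)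
    (hb : Sum.inl () ∉ T) (k : Fin n) : Sum.inr (k, false) ∈ T ∨ Sum.inr (k, true) ∈ T := by
  rcases hT with rfl | ⟨f, rfl⟩
  · simp at hb
  · cases h : f k <;> simp [h]

/-- If nobody uses the bypass in a feasible profile, every unit-cost resource is in use. -/
theorem resLoad_unit_pos {n : ℕ} (hn : 0 < n) {τ : Fin n → Finset (ExRes n)}
    (hτ : ∀ i, τ i ∈ StEx13 n) (hf : FeasibleC (cEx13 n) τ)
    (hb : ∀ i, Sum.inl () ∉ τ i) (k : Fin n) : 0 < resLoad τ (Sum.inr (k, true)) := by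
  by_contra h0
  have hz : ∀ i, Sum.inr (k, false) ∈ τ i := fun i =>
    (mem_or_mem_of_mem_StEx13 (hτ i) (hb i) k).resolve_right
      fun h => h0 (resLoad_pos_of_mem h)
  have hk : resLoad τ (Sum.inr (k, false)) ≤ n - 1 := hf (Sum.inr (k, false))
  simp only [resLoad, hz, Finset.filter_true, Finset.card_univ, Fintype.card_fin] at hk
  omega

theorem socialCostC_eq_of_bypass_unused {n : ℕ} (hn : 0 < n) (ε : ℝ)
    {τ : Fin n → Finset (ExRes n)} (hτ : ∀ i, τ i ∈ StEx13 n) (hf : FeasibleC (cEx13 n) τ)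
    (hb : ∀ i, Sum.inl () ∉ τ i) : socialCostC (pEx13 n ε) τ = n := by
  have h0 : resLoad τ (Sum.inl ()) = 0 := by simp [resLoad, hb]
  have h1 : ∀ k, resLoad τ (Sum.inr (k, true)) ≠ 0 := fun k =>
    (resLoad_unit_pos hn hτ hf hb k).ne'
  simp [socialCostC_eq_sum_used, Fintype.sum_prod_type, h0, h1, pEx13]

theorem one_add_le_socialCostC_of_bypass_used {n : ℕ} {ε : ℝ} (hε : 0 ≤ ε)
    {τ : Fin n → Finset (ExRes n)} {i : Fin n} (hi : Sum.inl () ∈ τ i) :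
    1 + ε ≤ socialCostC (pEx13 n ε) τ := by
  rw [socialCostC_eq_sum_used]
  have h := Finset.single_le_sum
    (f := fun e => if resLoad τ e = 0 then 0 else pEx13 n ε e)
    (fun e _ => by
      split_ifs
      exacts [le_rfl, pEx13_nonneg hε e])
    (Finset.mem_univ (Sum.inl ()))
  simpa [(resLoad_pos_of_mem hi).ne', pEx13] using h

theorem one_add_le_agentCostC_of_bypass {n : ℕ} {ε : ℝ} (hε : 0 ≤ ε)
    {τ : Fin n → Finset (ExRes n)} (hf : FeasibleC (cEx13 n) τ) {i : Fin n}
    (hi : Sum.inl () ∈ τ i) : 1 + ε ≤ agentCostC (pEx13 n ε) τ i := by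
  have h := Finset.single_le_sum
    (f := fun e => pEx13 n ε e / (resLoad τ e : ℝ))
    (fun e _ => div_nonneg (pEx13_nonneg hε e) (Nat.cast_nonneg _)) hi
  have hl : resLoad τ (Sum.inl ()) = 1 :=
    le_antisymm (hf (Sum.inl ())) (resLoad_pos_of_mem hi)
  simpa [hl, pEx13, agentCostC] using h

theorem mem_sEx13 {n : ℕ} {i k : Fin n} {b : Bool} :
    Sum.inr (k, b) ∈ sEx13 n i ↔ decide (k = i) = b := by
  simp [sEx13]

theorem bypass_notMem_sEx13 {n : ℕ} (i : Fin n) : Sum.inl () ∉ sEx13 n i := by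
  simp [sEx13]

theorem sEx13_mem_StEx13 {n : ℕ} (i : Fin n) : sEx13 n i ∈ StEx13 n :=
  Or.inr ⟨_, rfl⟩

theorem resLoad_sEx13_unit {n : ℕ} (k : Fin n) :
    resLoad (sEx13 n) (Sum.inr (k, true)) = 1 := by
  simp [resLoad, mem_sEx13, Finset.filter_eq]

theorem feasibleC_sEx13 {n : ℕ} : FeasibleC (cEx13 n) (sEx13 n) := by
  rintro (_ | ⟨k, _ | _⟩)
  · simp [resLoad, sEx13]
  · have h : (Finset.univ.filter fun i => Sum.inr (k, false) ∈ sEx13 n i)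
        = Finset.univ.erase k := by
      ext i
      simp [mem_sEx13, eq_comm]
    simp [resLoad, h, cEx13]
  · rw [resLoad_sEx13_unit]
    exact k.pos

theorem agentCostC_of_eq_sEx13 {n : ℕ} (ε : ℝ) {τ : Fin n → Finset (ExRes n)} {i : Fin n}
    (hi : τ i = sEx13 n i) :
    agentCostC (pEx13 n ε) τ i = 1 / (resLoad τ (Sum.inr (i, true)) : ℝ) := by
  have hinj : Function.Injective fun k : Fin n => (Sum.inr (k, decide (k = i)) : ExRes n) :=
    fun a b h => congrArg Prod.fst (Sum.inr.inj h)
  rw [agentCostC, hi, sEx13, Finset.sum_image hinj.injOn,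
    Finset.sum_eq_single i]
  · simp [pEx13]
  · intro k _ hk
    simp [hk, pEx13]
  · simp

theorem isStrongEqC_sEx13 {n : ℕ} {ε : ℝ} (hε : 0 ≤ ε) :
    IsStrongEqC (fun _ => StEx13 n) (pEx13 n ε) (cEx13 n) (sEx13 n) := by
  refine ⟨sEx13_mem_StEx13, feasibleC_sEx13, ?_⟩
  rintro ⟨C, τ, ⟨j, hj⟩, hτ, hf, hout, himp⟩
  have hin : ∀ i ∈ C, agentCostC (pEx13 n ε) τ i < 1 := fun i hi => by
    simpa [agentCostC_of_eq_sEx13, resLoad_sEx13_unit] using himp i hi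
  have hb : ∀ i, Sum.inl () ∉ τ i := by
    intro i hi
    by_cases hC : i ∈ C
    · linarith [hin i hC, one_add_le_agentCostC_of_bypass hε hf hi]
    · exact bypass_notMem_sEx13 i (hout i hC ▸ hi)
  have hle : ∀ i, agentCostC (pEx13 n ε) τ i ≤ 1 := by
    intro i
    by_cases hC : i ∈ C
    · exact (hin i hC).le
    · rw [agentCostC_of_eq_sEx13 ε (hout i hC)]
      have hpos : 1 ≤ resLoad τ (Sum.inr (i, true)) := resLoad_unit_pos j.pos hτ hf hb i
      exact div_le_one_of_le₀ (by exact_mod_cast hpos) (Nat.cast_nonneg _)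
  have hlt : socialCostC (pEx13 n ε) τ < ∑ _i : Fin n, (1 : ℝ) :=
    Finset.sum_lt_sum (fun i _ => hle i) ⟨j, Finset.mem_univ j, hin j hj⟩
  rw [socialCostC_eq_of_bypass_unused j.pos ε hτ hf hb] at hlt
  simp at hlt

/-- The profile in which agent `j` takes the bypass and all others use only zero-cost
resources. -/
def bypassProfile {n : ℕ} (j : Fin n) : Fin n → Finset (ExRes n) := fun i =>
  if i = j then {Sum.inl ()} else Finset.univ.image fun k => Sum.inr (k, false)

theorem bypassProfile_mem_StEx13 {n : ℕ} (j i : Fin n) : bypassProfile j i ∈ StEx13 n := by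
  unfold bypassProfile
  split_ifs
  · exact Or.inl rfl
  · exact Or.inr ⟨fun _ => false, rfl⟩

theorem resLoad_bypassProfile_bypass {n : ℕ} (j : Fin n) :
    resLoad (bypassProfile j) (Sum.inl ()) = 1 := by
  have h : ∀ i, Sum.inl () ∈ bypassProfile j i ↔ i = j := by
    intro i
    by_cases hi : i = j <;> simp [bypassProfile, hi]
  simp [resLoad, h, Finset.filter_eq']

theorem resLoad_bypassProfile_zero {n : ℕ} (j k : Fin n) :
    resLoad (bypassProfile j) (Sum.inr (k, false)) = n - 1 := by
  have h : ∀ i, Sum.inr (k, false) ∈ bypassProfile j i ↔ i ≠ j := by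
    intro i
    by_cases hi : i = j <;> simp [bypassProfile, hi]
  simp [resLoad, h, Finset.filter_ne']

theorem resLoad_bypassProfile_unit {n : ℕ} (j k : Fin n) :
    resLoad (bypassProfile j) (Sum.inr (k, true)) = 0 := by
  have h : ∀ i, Sum.inr (k, true) ∉ bypassProfile j i := by
    intro i
    by_cases hi : i = j <;> simp [bypassProfile, hi]
  simp [resLoad, h]

theorem feasibleC_bypassProfile {n : ℕ} (j : Fin n) :
    FeasibleC (cEx13 n) (bypassProfile j) := by
  rintro (_ | ⟨k, _ | _⟩)
  · exact (resLoad_bypassProfile_bypass j).le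
  · exact (resLoad_bypassProfile_zero j k).le
  · exact (resLoad_bypassProfile_unit j k).trans_le (Nat.zero_le _)

theorem socialCostC_bypassProfile {n : ℕ} (ε : ℝ) (j : Fin n) :
    socialCostC (pEx13 n ε) (bypassProfile j) = 1 + ε := by
  simp [socialCostC_eq_sum_used, Fintype.sum_prod_type, resLoad_bypassProfile_bypass,
    resLoad_bypassProfile_unit, pEx13]

/-- In the example game with `n ≥ 2` agents and `0 < ε < 1`: (1) the profile in which
agent `i` plays `{o_i} ∪ {z_k : k ≠ i}` is a strong equilibrium of social cost `n`;
(2) the minimum social cost over all feasible profiles equals `1 + ε`. Consequently,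
the strong price of anarchy of this game is at least `n / (1 + ε)`. -/
theorem example_game_SPoA_ge_n_div_one_add_eps
    (n : ℕ) (hn : 2 ≤ n) (ε : ℝ) (hε0 : 0 < ε) (hε1 : ε < 1) :
    IsStrongEqC (fun _ => StEx13 n) (pEx13 n ε) (cEx13 n) (sEx13 n) ∧
    socialCostC (pEx13 n ε) (sEx13 n) = n ∧
    IsLeast {x : ℝ | ∃ τ : Fin n → Finset (ExRes n),
        (∀ i, τ i ∈ StEx13 n) ∧ FeasibleC (cEx13 n) τ ∧ socialCostC (pEx13 n ε) τ = x}
      (1 + ε) ∧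
    (n : ℝ) / (1 + ε) ≤ socialCostC (pEx13 n ε) (sEx13 n) / (1 + ε) := by
  have hn0 : 0 < n := by omega
  have hs : socialCostC (pEx13 n ε) (sEx13 n) = n :=
    socialCostC_eq_of_bypass_unused hn0 ε sEx13_mem_StEx13 feasibleC_sEx13 bypass_notMem_sEx13
  refine ⟨isStrongEqC_sEx13 hε0.le, hs, ⟨?_, ?_⟩, by rw [hs]⟩
  · exact ⟨bypassProfile ⟨0, hn0⟩, bypassProfile_mem_StEx13 _, feasibleC_bypassProfile _,
      socialCostC_bypassProfile ε _⟩
  · rintro x ⟨τ, hτ, hf, rfl⟩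
    by_cases hb : ∃ i, Sum.inl () ∈ τ i
    · obtain ⟨i, hi⟩ := hb
      exact one_add_le_socialCostC_of_bypass_used hε0.le hi
    · rw [socialCostC_eq_of_bypass_unused hn0 ε hτ hf (not_exists.mp hb)]
      have h2 : (2 : ℝ) ≤ n := by exact_mod_cast hn
      linarith
end

section
/- Let σ be a strong equilibrium of a feasible single-source capacitated cost-sharing game on a series of k parallel-edge blocks with boundary sinks. Then there exists a feasible profile σ* whose social cost is minimal among all feasible profiles, such that for every set C ⊆ Fin n of agents, the combined profile that plays σ*'s strategy for agents in C and σ's strategy for agents outside C is feasible. -/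
/-- The load of edge `e` of block `j`: the number of agents whose path reaches
block `j` (i.e. `j < m i`, with blocks indexed from `0`) and who chose `e` there. -/
def ssLoad {n k : ℕ} {E : Fin k → Type*} [∀ j, Fintype (E j)] [∀ j, DecidableEq (E j)]
    (m : Fin n → ℕ) (σ : Fin n → ∀ j, E j) (j : Fin k) (e : E j) : ℕ :=
  (Finset.univ.filter fun i => (j : ℕ) < m i ∧ σ i j = e).card

/-- A profile is feasible if no edge load exceeds its capacity. -/
def FeasibleS {n k : ℕ} {E : Fin k → Type*} [∀ j, Fintype (E j)] [∀ j, DecidableEq (E j)]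
    (m : Fin n → ℕ) (c : ∀ j, E j → ℕ) (σ : Fin n → ∀ j, E j) : Prop :=
  ∀ j e, ssLoad m σ j e ≤ c j e

/-- The cost of agent `i`: over the blocks her path traverses, the cost of her chosen
edge divided equally among its users. -/
noncomputable def agentCostS {n k : ℕ} {E : Fin k → Type*}
    [∀ j, Fintype (E j)] [∀ j, DecidableEq (E j)]
    (m : Fin n → ℕ) (p : ∀ j, E j → ℝ) (σ : Fin n → ∀ j, E j) (i : Fin n) : ℝ :=
  ∑ j : Fin k, if (j : ℕ) < m i then p j (σ i j) / (ssLoad m σ j (σ i j) : ℝ) else 0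

/-- The social cost of a profile: the sum of all agents' costs. -/
noncomputable def socialCostS {n k : ℕ} {E : Fin k → Type*}
    [∀ j, Fintype (E j)] [∀ j, DecidableEq (E j)]
    (m : Fin n → ℕ) (p : ∀ j, E j → ℝ) (σ : Fin n → ∀ j, E j) : ℝ :=
  ∑ i, agentCostS m p σ i

/-- A feasible profile is a strong equilibrium if no nonempty coalition has a feasible
deviation, agreeing with the original profile outside the coalition (on all blocks its
members actually traverse), that strictly decreases the cost of each of its members. -/
def IsStrongEqS {n k : ℕ} {E : Fin k → Type*} [∀ j, Fintype (E j)] [∀ j, DecidableEq (E j)]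
    (m : Fin n → ℕ) (p : ∀ j, E j → ℝ) (c : ∀ j, E j → ℕ) (σ : Fin n → ∀ j, E j) : Prop :=
  FeasibleS m c σ ∧
    ¬ ∃ (C : Finset (Fin n)) (σ' : Fin n → ∀ j, E j),
        C.Nonempty ∧ FeasibleS m c σ' ∧
        (∀ i ∉ C, ∀ j : Fin k, (j : ℕ) < m i → σ' i j = σ i j) ∧
        ∀ i ∈ C, agentCostS m p σ' i < agentCostS m p σ i

theorem socialCostS_congr_ssLoad {n k : ℕ} {E : Fin k → Type*} [∀ j, Fintype (E j)]
    [∀ j, DecidableEq (E j)] (m : Fin n → ℕ) (p : ∀ j, E j → ℝ) {σ τ : Fin n → ∀ j, E j}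
    (h : ∀ j e, ssLoad m σ j e = ssLoad m τ j e) :
    socialCostS m p σ = socialCostS m p τ := by
  have key : ∀ ρ : Fin n → ∀ j, E j, socialCostS m p ρ =
      ∑ j, ∑ e, (ssLoad m ρ j e : ℝ) * (p j e / (ssLoad m ρ j e : ℝ)) := by
    intro ρ
    unfold socialCostS agentCostS
    rw [Finset.sum_comm]
    refine Finset.sum_congr rfl fun j _ => ?_
    rw [← Finset.sum_filter, ← Finset.sum_fiberwise _ (fun i => ρ i j)]
    refine Finset.sum_congr rfl fun e _ => ?_
    rw [Finset.filter_filter]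
    rw [← nsmul_eq_mul, ssLoad, ← Finset.sum_const]
    refine Finset.sum_congr rfl fun i hi => ?_
    rw [(Finset.mem_filter.1 hi).2.2]
    rfl
  rw [key, key]
  simp only [h]

/-- The profile in which agents `a` and `b` exchange their choices in block `j`. -/
def swapAt {n k : ℕ} {E : Fin k → Type*} (τ : Fin n → ∀ j, E j) (j : Fin k) (a b : Fin n) :
    Fin n → ∀ j, E j :=
  fun i => Function.update (τ i) j (τ (Equiv.swap a b i) j)

theorem ssLoad_swapAt {n k : ℕ} {E : Fin k → Type*} [∀ j, Fintype (E j)]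
    [∀ j, DecidableEq (E j)] (m : Fin n → ℕ) (τ : Fin n → ∀ j, E j) {j : Fin k} {a b : Fin n}
    (ha : (j : ℕ) < m a) (hb : (j : ℕ) < m b) (j' : Fin k) (e : E j') :
    ssLoad m (swapAt τ j a b) j' e = ssLoad m τ j' e := by
  unfold ssLoad swapAt
  by_cases hj : j' = j
  · subst hj
    refine Finset.card_equiv (Equiv.swap a b) fun i => ?_
    have hm : (j' : ℕ) < m (Equiv.swap a b i) ↔ (j' : ℕ) < m i := by
      rcases eq_or_ne i a with rfl | hia
      · simp [ha, hb]
      rcases eq_or_ne i b with rfl | hib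
      · simp [ha, hb]
      rw [Equiv.swap_apply_of_ne_of_ne hia hib]
    simp [hm]
  · simp [Function.update_of_ne hj]

/-- The pairs of an agent and a block she traverses in which `σ` and `τ` choose the same edge. -/
def agreement {n k : ℕ} {E : Fin k → Type*} [∀ j, DecidableEq (E j)]
    (m : Fin n → ℕ) (σ τ : Fin n → ∀ j, E j) : Finset (Fin n × Fin k) :=
  Finset.univ.filter fun x => (x.2 : ℕ) < m x.1 ∧ τ x.1 x.2 = σ x.1 x.2

theorem mem_agreement {n k : ℕ} {E : Fin k → Type*} [∀ j, DecidableEq (E j)]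
    {m : Fin n → ℕ} {σ τ : Fin n → ∀ j, E j} {i : Fin n} {j : Fin k} :
    (i, j) ∈ agreement m σ τ ↔ (j : ℕ) < m i ∧ τ i j = σ i j := by
  simp [agreement]

theorem agreement_ssubset_swapAt {n k : ℕ} {E : Fin k → Type*} [∀ j, DecidableEq (E j)]
    (m : Fin n → ℕ) {σ τ : Fin n → ∀ j, E j} {j : Fin k} {a b : Fin n}
    (hb : (j : ℕ) < m b) (hab : τ a j = σ b j) (hane : τ a j ≠ σ a j) (hbne : τ b j ≠ σ b j) :
    agreement m σ τ ⊂ agreement m σ (swapAt τ j a b) := by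
  refine Finset.ssubset_iff_of_subset ?_ |>.2 ⟨(b, j), ?_, ?_⟩
  · rintro ⟨i, j'⟩ hi
    rw [mem_agreement] at hi ⊢
    refine ⟨hi.1, ?_⟩
    by_cases hj : j' = j
    · subst hj
      have hia : i ≠ a := by rintro rfl; exact hane hi.2
      have hib : i ≠ b := by rintro rfl; exact hbne hi.2
      simpa [swapAt, Equiv.swap_apply_of_ne_of_ne hia hib] using hi.2
    · simpa [swapAt, Function.update_of_ne hj] using hi.2
  · simp [mem_agreement, swapAt, hb, hab]
  · simp [mem_agreement, hbne]

/-- If no exchange of choices in a block brings `τ` closer to `σ`, then all combinations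
of the two feasible profiles are feasible. -/
theorem feasibleS_ite_of_agreement_maximal {n k : ℕ} {E : Fin k → Type*} [∀ j, Fintype (E j)]
    [∀ j, DecidableEq (E j)] {m : Fin n → ℕ} {c : ∀ j, E j → ℕ} {σ τ : Fin n → ∀ j, E j}
    (hσ : FeasibleS m c σ) (hτ : FeasibleS m c τ)
    (hmax : ∀ (j : Fin k) (a b : Fin n), (j : ℕ) < m a → (j : ℕ) < m b →
      (agreement m σ (swapAt τ j a b)).card ≤ (agreement m σ τ).card)
    (C : Finset (Fin n)) : FeasibleS m c (fun i => if i ∈ C then τ i else σ i) := by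
  intro j e
  by_contra! hlt
  obtain ⟨a, ha, haσ⟩ := Finset.exists_mem_notMem_of_card_lt_card ((hσ j e).trans_lt hlt)
  obtain ⟨b, hb, hbτ⟩ := Finset.exists_mem_notMem_of_card_lt_card ((hτ j e).trans_lt hlt)
  simp only [Finset.mem_filter, Finset.mem_univ, true_and] at ha haσ hb hbτ
  have haσne : σ a j ≠ e := fun h => haσ ⟨ha.1, h⟩
  have hbτne : τ b j ≠ e := fun h => hbτ ⟨hb.1, h⟩
  have haτ : τ a j = e := by
    have := ha.2
    split_ifs at this
    · exact this
    · exact absurd this haσne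
  have hbσ : σ b j = e := by
    have := hb.2
    split_ifs at this
    · exact absurd this hbτne
    · exact this
  refine (hmax j a b ha.1 hb.1).not_gt (Finset.card_lt_card ?_)
  exact agreement_ssubset_swapAt m hb.1 (haτ.trans hbσ.symm) (haτ ▸ haσne.symm) (hbσ ▸ hbτne)

/-- For every strong equilibrium `σ` of a feasible single-source capacitated
cost-sharing game on a series of `k` parallel-edge blocks with boundary sinks, there
is a socially optimal feasible profile `σ*` such that for every coalition `C`, the
combined profile playing `σ*` inside `C` and `σ` outside `C` is feasible. -/
theorem single_source_blocks_exists_optimal_combinable_profile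
    {n k : ℕ} (hn : 1 ≤ n) (hk : 1 ≤ k)
    {E : Fin k → Type*} [∀ j, Fintype (E j)] [∀ j, DecidableEq (E j)] [∀ j, Nonempty (E j)]
    (p : ∀ j, E j → ℝ) (hp : ∀ j e, 0 ≤ p j e) (c : ∀ j, E j → ℕ)
    (m : Fin n → ℕ) (hm : ∀ i, 1 ≤ m i ∧ m i ≤ k)
    (σ : Fin n → ∀ j, E j) (hσ : IsStrongEqS m p c σ) :
    ∃ σstar : Fin n → ∀ j, E j, FeasibleS m c σstar ∧
      (∀ τ : Fin n → ∀ j, E j, FeasibleS m c τ →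
        socialCostS m p σstar ≤ socialCostS m p τ) ∧
      ∀ C : Finset (Fin n),
        FeasibleS m c (fun i => if i ∈ C then σstar i else σ i) := by
  classical
  obtain ⟨τ₀, hτ₀, hmin⟩ := Set.exists_min_image {τ | FeasibleS m c τ} (socialCostS m p)
    (Set.toFinite _) ⟨σ, hσ.1⟩
  obtain ⟨τ, ⟨hτ, hτopt⟩, hmax⟩ := Set.exists_max_image
    {τ | FeasibleS m c τ ∧ ∀ ρ, FeasibleS m c ρ → socialCostS m p τ ≤ socialCostS m p ρ}
    (fun τ => (agreement m σ τ).card) (Set.toFinite _) ⟨τ₀, hτ₀, hmin⟩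
  refine ⟨τ, hτ, hτopt, feasibleS_ite_of_agreement_maximal hσ.1 hτ fun j a b ha hb => ?_⟩
  have hload := ssLoad_swapAt m τ ha hb
  refine hmax _ ⟨fun j' e => (hload j' e).trans_le (hτ j' e), fun ρ hρ => ?_⟩
  rw [socialCostS_congr_ssLoad m p hload]
  exact hτopt ρ hρ
end
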